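/- arXiv:1712.07421 — 3 statements merged into one kernel-verified Lean document; each statement's English description precedes it below -/
import Mathlib

section
/- For every integer n ≥ 4, the flip graph of triangulations G_n^T of a convex n-gon contains a 1-rainbow cycle, i.e., a directed cycle of length C(n,2) − n visiting no triangulation twice, along which every diagonal in E_n appears as an arc label exactly once. -/
/-! Rainbow cycles in the flip graph of triangulations of a convex `n`-gon.
The vertices of the polygon are the elements of `ZMod n`, labeled in clockwise
cyclic order. -/

/-- `x` lies on the arc strictly between `a` and `b` (going in the direction of
increasing labels) in the cyclic order on `ZMod n`. -/
def StrictBtw (n : ℕ) (a x b : ZMod n) : Prop :=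
  0 < (x - a).val ∧ (x - a).val < (b - a).val

/-- Two unordered pairs of vertices of the convex `n`-gon cross: all four
vertices are distinct and exactly one endpoint of the second pair lies on each
of the two arcs strictly between the endpoints of the first pair. -/
def Crosses (n : ℕ) (e f : Sym2 (ZMod n)) : Prop :=
  ∃ a b c d : ZMod n, e = s(a, b) ∧ f = s(c, d) ∧
    a ≠ b ∧ a ≠ c ∧ a ≠ d ∧ b ≠ c ∧ b ≠ d ∧ c ≠ d ∧
    StrictBtw n a c b ∧ StrictBtw n b d a

/-- A diagonal of the convex `n`-gon: an unordered pair of distinct,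
non-adjacent vertices. -/
def IsDiagonal (n : ℕ) (e : Sym2 (ZMod n)) : Prop :=
  ∃ a b : ZMod n, e = s(a, b) ∧ a ≠ b ∧ a ≠ b + 1 ∧ b ≠ a + 1

/-- A triangulation of the convex `n`-gon: an inclusion-maximal set of pairwise
non-crossing diagonals. -/
def IsTriangulation (n : ℕ) (T : Finset (Sym2 (ZMod n))) : Prop :=
  (∀ e ∈ T, IsDiagonal n e) ∧
  (∀ e ∈ T, ∀ f ∈ T, ¬ Crosses n e f) ∧
  (∀ f, IsDiagonal n f → (∀ e ∈ T, ¬ Crosses n e f) → f ∈ T)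

/-- An `r`-rainbow cycle of length `L` in the flip graph `G_n^T` of
triangulations of the convex `n`-gon, encoded as an `L`-periodic sequence `V`
of triangulations: consecutive triangulations differ in a flip (removing one
diagonal `e` and inserting another diagonal `f`, which is the label of the
arc), no triangulation is visited twice within a period, and every diagonal
appears as an arc label (i.e. enters the triangulation) exactly `r` times per
period. -/
def IsRainbowCycleT (n r L : ℕ) (V : ℕ → Finset (Sym2 (ZMod n))) : Prop :=
  0 < L ∧
  (∀ i, V (i + L) = V i) ∧
  (∀ i < L, ∀ j < L, V i = V j → i = j) ∧
  (∀ i, IsTriangulation n (V i)) ∧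
  (∀ i, ∃ e f, e ∈ V i ∧ f ∉ V i ∧ V (i + 1) = insert f ((V i).erase e)) ∧
  (∀ g : Sym2 (ZMod n), IsDiagonal n g →
    ((Finset.range L).filter (fun i => g ∈ V (i + 1) ∧ g ∉ V i)).card = r)

namespace RainbowCycle

/-- Vertex labels `a < b < n` of a diagonal of the `n`-gon. -/
def Valid (n : ℕ) (p : ℕ × ℕ) : Prop :=
  p.1 + 2 ≤ p.2 ∧ p.2 < n ∧ ¬(p.1 = 0 ∧ p.2 + 1 = n)

/-- The cyclic successor in the lexicographic order on the valid pairs. -/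
def next (n : ℕ) (p : ℕ × ℕ) : ℕ × ℕ :=
  if p.1 + 3 = n then (0, 2)
  else if p.2 + 1 = n ∨ (p.1 = 0 ∧ p.2 + 2 = n) then (p.1 + 1, p.1 + 3)
  else (p.1, p.2 + 1)

/-- The pairs `q` in the triangulation reached immediately after inserting `p`, when the
diagonals are inserted in cyclic lexicographic order. -/
def Mem (n : ℕ) (p q : ℕ × ℕ) : Prop :=
  Valid n q ∧
    ((q.1 = p.1 ∧ q.2 ≤ p.2) ∨ (q.1 + 1 = p.1 ∧ p.2 ≤ q.2) ∨
      (q.2 + 1 = n ∧ 1 ≤ q.1 ∧ q.1 < p.1) ∨ (q.2 + 1 = n ∧ p.1 = 0 ∧ p.2 ≤ q.1))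

/-- The diagonal removed when `p` is inserted. -/
def removed (n : ℕ) (p : ℕ × ℕ) : ℕ × ℕ :=
  if p.1 = 0 then (p.2 - 1, n - 1) else (p.1 - 1, p.2 - 1)

/-- The number of pairs following `p` in the lexicographic order. -/
def remaining (n : ℕ) (p : ℕ × ℕ) : ℕ :=
  (n - 2 - p.1).choose 2 + (if p.1 = 0 then n - 2 - p.2 else n - 1 - p.2)

/-- The pair with labels `a` and `b` as a pair of polygon vertices. -/
def toPair (n : ℕ) (p : ℕ × ℕ) : Sym2 (ZMod n) := s((p.1 : ZMod n), (p.2 : ZMod n))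

open Classical in
/-- The triangulation reached immediately after inserting `p`. -/
noncomputable def triang (n : ℕ) (p : ℕ × ℕ) : Finset (Sym2 (ZMod n)) :=
  ((Finset.range n ×ˢ Finset.range n).filter (Mem n p)).image (toPair n)

variable {n : ℕ}

/-! ### The lexicographic order -/

theorem valid_next (hn : 4 ≤ n) {p : ℕ × ℕ} (hp : Valid n p) : Valid n (next n p) := by
  obtain ⟨i, j⟩ := p
  simp only [Valid, next] at *
  split_ifs <;> simp only [false_and, not_false_eq_true, and_true] <;> omega

theorem choose_two_succ (m : ℕ) : (m + 1).choose 2 = m.choose 2 + m := by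
  rw [Nat.choose_succ_succ' m 1, Nat.choose_one_right, add_comm]

theorem remaining_next {p : ℕ × ℕ} (hp : Valid n p) (hlast : p.1 + 3 ≠ n) :
    remaining n (next n p) + 1 = remaining n p := by
  obtain ⟨i, j⟩ := p
  simp only [Valid, next, remaining] at *
  rw [if_neg hlast]
  have h : n - 2 - i = (n - 2 - (i + 1)) + 1 := by omega
  have h2 := choose_two_succ (n - 2 - (i + 1))
  rw [← h] at h2
  split_ifs <;> dsimp only at * <;> omega

theorem remaining_lt_of_fst_lt {p q : ℕ × ℕ} (hp : Valid n p) (hq : Valid n q)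
    (h : p.1 < q.1) : remaining n q < remaining n p := by
  obtain ⟨i, j⟩ := p
  obtain ⟨k, l⟩ := q
  simp only [Valid, remaining] at *
  have h2 := choose_two_succ (n - 2 - k)
  have h3 : (n - 2 - k + 1).choose 2 ≤ (n - 2 - i).choose 2 :=
    Nat.choose_le_choose 2 (by omega)
  split_ifs <;> omega

theorem remaining_injOn {p q : ℕ × ℕ} (hp : Valid n p) (hq : Valid n q)
    (h : remaining n p = remaining n q) : p = q := by
  rcases lt_trichotomy p.1 q.1 with hlt | heq | hgt
  · exact absurd h (remaining_lt_of_fst_lt hp hq hlt).ne'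
  · obtain ⟨i, j⟩ := p
    obtain ⟨k, l⟩ := q
    simp only [Valid, remaining, Prod.mk.injEq] at *
    subst heq
    split_ifs at h <;> omega
  · exact absurd h (remaining_lt_of_fst_lt hq hp hgt).ne

theorem remaining_le (hn : 4 ≤ n) {p : ℕ × ℕ} (hp : Valid n p) :
    remaining n p ≤ remaining n (0, 2) := by
  rcases Nat.eq_zero_or_pos p.1 with h | h
  · obtain ⟨i, j⟩ := p
    dsimp only at h
    subst h
    simp only [Valid, remaining, if_true] at *
    omega
  · exact (remaining_lt_of_fst_lt (p := (0, 2)) (by simp only [Valid]; omega) hp h).le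

theorem remaining_first (hn : 4 ≤ n) : remaining n (0, 2) + 1 = n.choose 2 - n := by
  have h1 := choose_two_succ (n - 1)
  have h2 := choose_two_succ (n - 2)
  rw [show n - 1 + 1 = n by omega] at h1
  rw [show n - 2 + 1 = n - 1 by omega] at h2
  simp only [remaining, if_true, Nat.sub_zero]
  omega

/-- The `t`-th pair in the cyclic lexicographic order. -/
def seq (n t : ℕ) : ℕ × ℕ := (next n)^[t] (0, 2)

theorem seq_succ (t : ℕ) : seq n (t + 1) = next n (seq n t) :=
  Function.iterate_succ_apply' _ _ _

theorem valid_seq (hn : 4 ≤ n) (t : ℕ) : Valid n (seq n t) := by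
  induction t with
  | zero => simp only [seq, Function.iterate_zero, id, Valid]; omega
  | succ t ih => rw [seq_succ]; exact valid_next hn ih

theorem remaining_seq (hn : 4 ≤ n) {t : ℕ} (ht : t < n.choose 2 - n) :
    remaining n (seq n t) + t + 1 = n.choose 2 - n := by
  induction t with
  | zero => exact remaining_first hn
  | succ t ih =>
    have ih := ih (by omega)
    have hv := valid_seq hn t
    by_cases hlast : (seq n t).1 + 3 = n
    · have h0 : remaining n (seq n t) = 0 := by
        have : n - 2 - (seq n t).1 = 1 := by omega
        simp only [remaining, this, Valid] at *
        rw [if_neg (by omega)]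
        norm_num
        omega
      omega
    · have := remaining_next hv hlast
      rw [seq_succ]
      omega

theorem seq_period (hn : 4 ≤ n) : seq n (n.choose 2 - n) = (0, 2) := by
  have hfirst := remaining_first hn
  obtain ⟨m, hm⟩ : ∃ m, n.choose 2 - n = m + 1 := ⟨_, hfirst.symm⟩
  have h := remaining_seq hn (t := m) (by omega)
  rw [hm, seq_succ]
  have hlast : (seq n m).1 + 3 = n := by
    by_contra hlast
    have := remaining_next (valid_seq hn m) hlast
    omega
  rw [next, if_pos hlast]

theorem seq_add_period (hn : 4 ≤ n) (t : ℕ) : seq n (t + (n.choose 2 - n)) = seq n t := by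
  have := seq_period hn
  rw [seq] at this ⊢
  rw [Function.iterate_add_apply, this, seq]

theorem seq_injOn (hn : 4 ≤ n) {s t : ℕ} (hs : s < n.choose 2 - n) (ht : t < n.choose 2 - n)
    (h : seq n s = seq n t) : s = t := by
  have h1 := remaining_seq hn hs
  have h2 := remaining_seq hn ht
  rw [h] at h1
  omega

theorem exists_seq_eq (hn : 4 ≤ n) {p : ℕ × ℕ} (hp : Valid n p) :
    ∃ t < n.choose 2 - n, seq n t = p := by
  have h1 := remaining_le hn hp
  have h2 := remaining_first hn
  have ht : n.choose 2 - n - 1 - remaining n p < n.choose 2 - n := by omega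
  refine ⟨_, ht, remaining_injOn (valid_seq hn _) hp ?_⟩
  have := remaining_seq hn ht
  omega

theorem existsUnique_seq_succ_eq (hn : 4 ≤ n) {p : ℕ × ℕ} (hp : Valid n p) :
    ∃ t < n.choose 2 - n, ∀ s < n.choose 2 - n, seq n (s + 1) = p ↔ s = t := by
  obtain ⟨t, ht, rfl⟩ := exists_seq_eq hn hp
  have h0 : seq n (n.choose 2 - n) = seq n 0 := seq_period hn
  have key : ∀ s < n.choose 2 - n, seq n (s + 1) = seq n t →
      s + 1 = t ∨ (t = 0 ∧ s + 1 = n.choose 2 - n) := by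
    intro s hs h
    rcases Nat.lt_or_ge (s + 1) (n.choose 2 - n) with h1 | h1
    · exact Or.inl (seq_injOn hn h1 ht h)
    · have h2 : s + 1 = n.choose 2 - n := by omega
      rw [h2, h0] at h
      exact Or.inr ⟨(seq_injOn hn (by omega) ht h).symm, h2⟩
  cases t with
  | zero =>
    refine ⟨n.choose 2 - n - 1, by omega, fun s hs => ⟨fun h => ?_, ?_⟩⟩
    · have := key s hs h
      omega
    · rintro rfl
      rw [Nat.sub_add_cancel (by omega), h0]
  | succ t =>
    refine ⟨t, by omega, fun s hs => ⟨fun h => ?_, ?_⟩⟩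
    · have := key s hs h
      omega
    · rintro rfl
      rfl

/-! ### Flips in terms of labels -/

theorem mem_self {p : ℕ × ℕ} (hp : Valid n p) : Mem n p p := ⟨hp, Or.inl ⟨rfl, le_rfl⟩⟩

theorem mem_antisymm {p q : ℕ × ℕ} (h : Mem n p q) (h' : Mem n q p) : p = q := by
  obtain ⟨i, j⟩ := p
  obtain ⟨k, l⟩ := q
  simp only [Mem, Valid, Prod.mk.injEq] at *
  omega

theorem mem_removed (hn : 4 ≤ n) {p : ℕ × ℕ} (hp : Valid n p) :
    Mem n p (removed n (next n p)) := by
  obtain ⟨i, j⟩ := p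
  simp only [Valid, Mem, removed, next] at *
  split_ifs <;>
    simp only [false_and, not_false_eq_true, not_true_eq_false, and_true] at * <;> omega

theorem not_mem_next (hn : 4 ≤ n) {p : ℕ × ℕ} (hp : Valid n p) : ¬ Mem n p (next n p) := by
  obtain ⟨i, j⟩ := p
  simp only [Valid, Mem, next] at *
  split_ifs <;> simp only [false_and, true_and, not_false_eq_true, and_true] at * <;> omega

theorem mem_next_iff (hn : 4 ≤ n) {p : ℕ × ℕ} (hp : Valid n p) (q : ℕ × ℕ) :
    Mem n (next n p) q ↔ q = next n p ∨ (q ≠ removed n (next n p) ∧ Mem n p q) := by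
  obtain ⟨i, j⟩ := p
  obtain ⟨k, l⟩ := q
  simp only [Valid, Mem, removed, next] at *
  split_ifs <;>
    simp only [Prod.mk.injEq, ne_eq, false_and, and_false, true_and, or_false, false_or,
      not_true_eq_false] at * <;> omega

/-! ### Crossings in terms of labels -/

/-- The crossing relation on increasing pairs of labels. -/
def LabelCross (p q : ℕ × ℕ) : Prop :=
  (p.1 < q.1 ∧ q.1 < p.2 ∧ p.2 < q.2) ∨ (q.1 < p.1 ∧ p.1 < q.2 ∧ q.2 < p.2)

theorem not_labelCross {p q r : ℕ × ℕ} (hq : Mem n p q) (hr : Mem n p r) :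
    ¬ LabelCross q r := by
  simp only [Mem, Valid, LabelCross] at *
  omega

theorem exists_labelCross {p q : ℕ × ℕ} (hp : Valid n p) (hq : Valid n q)
    (h : ¬ Mem n p q) : ∃ r, Mem n p r ∧ LabelCross r q := by
  obtain ⟨i, j⟩ := p
  obtain ⟨c, d⟩ := q
  have witness : ∀ a b, Mem n (i, j) (a, b) ∧ LabelCross (a, b) (c, d) →
      ∃ r, Mem n (i, j) r ∧ LabelCross r (c, d) := fun a b h => ⟨_, h⟩
  simp only [Mem, Valid, LabelCross] at hp hq h witness ⊢
  rcases Nat.eq_zero_or_pos i with rfl | hi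
  · by_cases hdj : d ≤ j
    · exact witness 0 (c + 1) (by omega)
    by_cases hc : c = 0
    · exact witness j (n - 1) (by omega)
    by_cases hcj : c < j
    · exact witness 0 j (by omega)
    · exact witness (c + 1) (n - 1) (by omega)
  · rcases lt_trichotomy (c + 1) i with hci | hci | hci
    · by_cases hd : i ≤ d
      · exact witness (i - 1) (n - 1) (by omega)
      · exact witness (c + 1) (n - 1) (by omega)
    · exact witness i j (by omega)
    · by_cases hdj : d ≤ j
      · exact witness i (c + 1) (by omega)
      by_cases hc : c = i
      · exact witness (i - 1) j (by omega)
      by_cases hcj : c < j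
      · exact witness i j (by omega)
      · exact witness (i - 1) (c + 1) (by omega)

theorem val_sub_natCast {a b : ℕ} (ha : a < n) (hb : b < n) :
    ((b : ZMod n) - (a : ZMod n)).val = if a ≤ b then b - a else n + b - a := by
  split_ifs with h
  · rw [← Nat.cast_sub h, ZMod.val_cast_of_lt (by omega)]
  · have : ((b : ZMod n) - (a : ZMod n)) = ((n + b - a : ℕ) : ZMod n) := by
      rw [Nat.cast_sub (by omega), Nat.cast_add, ZMod.natCast_self, zero_add]
    rw [this, ZMod.val_cast_of_lt (by omega)]

theorem natCast_inj_of_lt {a b : ℕ} (ha : a < n) (hb : b < n) :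
    (a : ZMod n) = (b : ZMod n) ↔ a = b := by
  refine ⟨fun h => ?_, congrArg _⟩
  rw [← ZMod.val_cast_of_lt ha, ← ZMod.val_cast_of_lt hb, h]

theorem exists_natCast_eq [NeZero n] (a : ZMod n) : ∃ k < n, (k : ZMod n) = a :=
  ⟨a.val, a.val_lt, ZMod.natCast_zmod_val a⟩

theorem toPair_injOn {p q : ℕ × ℕ} (hp : Valid n p) (hq : Valid n q)
    (h : toPair n p = toPair n q) : p = q := by
  obtain ⟨i, j⟩ := p
  obtain ⟨k, l⟩ := q
  simp only [Valid, toPair, Sym2.eq_iff] at *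
  rw [natCast_inj_of_lt (by omega) (by omega), natCast_inj_of_lt (by omega) (by omega),
    natCast_inj_of_lt (by omega) (by omega), natCast_inj_of_lt (by omega) (by omega)] at h
  rw [Prod.mk.injEq]
  omega

theorem strictBtw_natCast {a b c : ℕ} (ha : a < n) (hb : b < n) (hc : c < n) :
    StrictBtw n (a : ZMod n) (b : ZMod n) (c : ZMod n) ↔
      (a < b ∧ b < c) ∨ (b < c ∧ c < a) ∨ (c < a ∧ a < b) := by
  rw [StrictBtw, val_sub_natCast ha hb, val_sub_natCast ha hc]
  split_ifs <;> omega

theorem crosses_toPair_iff [NeZero n] {p q : ℕ × ℕ} (hp : Valid n p) (hq : Valid n q) :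
    Crosses n (toPair n p) (toPair n q) ↔ LabelCross p q := by
  obtain ⟨i, j⟩ := p
  obtain ⟨k, l⟩ := q
  simp only [Valid, toPair, LabelCross] at *
  have hi : i < n := by omega
  have hj : j < n := by omega
  have hk : k < n := by omega
  have hl : l < n := by omega
  constructor
  · rintro ⟨a, b, c, d, he, hf, -, -, -, -, -, -, h1, h2⟩
    rw [Sym2.eq_iff] at he hf
    rcases he with ⟨rfl, rfl⟩ | ⟨rfl, rfl⟩ <;> rcases hf with ⟨rfl, rfl⟩ | ⟨rfl, rfl⟩ <;>
      rw [strictBtw_natCast (by assumption) (by assumption) (by assumption)] at h1 h2 <;> omega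
  · rintro (h | h)
    · refine ⟨i, j, k, l, rfl, rfl, ?_⟩
      simp only [ne_eq, natCast_inj_of_lt, strictBtw_natCast, hi, hj, hk, hl]
      omega
    · refine ⟨i, j, l, k, rfl, Sym2.eq_swap, ?_⟩
      simp only [ne_eq, natCast_inj_of_lt, strictBtw_natCast, hi, hj, hk, hl]
      omega

theorem natCast_eq_succ_iff {a b : ℕ} (ha : a < n) (hb : b < n) :
    (a : ZMod n) = (b : ZMod n) + 1 ↔ a = b + 1 ∨ (a = 0 ∧ b + 1 = n) := by
  rcases Nat.lt_or_ge (b + 1) n with h | h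
  · rw [← Nat.cast_succ, natCast_inj_of_lt ha h]
    omega
  · have hb' : b + 1 = n := by omega
    rw [← Nat.cast_succ, Nat.succ_eq_add_one, hb', ZMod.natCast_self, ← Nat.cast_zero,
      natCast_inj_of_lt ha (by omega)]
    omega

theorem isDiagonal_iff [NeZero n] (g : Sym2 (ZMod n)) :
    IsDiagonal n g ↔ ∃ p, Valid n p ∧ toPair n p = g := by
  constructor
  · rintro ⟨a, b, rfl, h1, h2, h3⟩
    obtain ⟨i, hi, rfl⟩ := exists_natCast_eq a
    obtain ⟨j, hj, rfl⟩ := exists_natCast_eq b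
    rw [ne_eq, natCast_inj_of_lt hi hj] at h1
    rw [ne_eq, natCast_eq_succ_iff hi hj] at h2
    rw [ne_eq, natCast_eq_succ_iff hj hi] at h3
    rcases Nat.lt_or_ge i j with h | h
    · exact ⟨(i, j), by simp only [Valid]; omega, rfl⟩
    · exact ⟨(j, i), by simp only [Valid]; omega, Sym2.eq_swap⟩
  · rintro ⟨⟨i, j⟩, hv, rfl⟩
    simp only [Valid] at hv
    refine ⟨i, j, rfl, ?_⟩
    rw [ne_eq, ne_eq, ne_eq, natCast_inj_of_lt (by omega) (by omega),
      natCast_eq_succ_iff (by omega) (by omega), natCast_eq_succ_iff (by omega) (by omega)]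
    omega

/-! ### The triangulations -/

theorem mem_triang {p : ℕ × ℕ} {g : Sym2 (ZMod n)} :
    g ∈ triang n p ↔ ∃ q, Mem n p q ∧ toPair n q = g := by
  simp only [triang, Finset.mem_image, Finset.mem_filter, Finset.mem_product, Finset.mem_range]
  refine exists_congr fun q => and_congr_left fun _ => and_iff_right_of_imp fun h => ?_
  have := h.1
  simp only [Valid] at this
  omega

theorem toPair_mem_triang {p q : ℕ × ℕ} (hq : Valid n q) :
    toPair n q ∈ triang n p ↔ Mem n p q := by
  rw [mem_triang]
  refine ⟨?_, fun h => ⟨q, h, rfl⟩⟩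
  rintro ⟨r, hr, h⟩
  rwa [← toPair_injOn hr.1 hq h]

theorem triang_injOn {p q : ℕ × ℕ} (hp : Valid n p) (hq : Valid n q)
    (h : triang n p = triang n q) : p = q :=
  mem_antisymm ((toPair_mem_triang hq).1 (h ▸ (toPair_mem_triang hq).2 (mem_self hq)))
    ((toPair_mem_triang hp).1 (h ▸ (toPair_mem_triang hp).2 (mem_self hp)))

theorem isTriangulation_triang [NeZero n] {p : ℕ × ℕ} (hp : Valid n p) :
    IsTriangulation n (triang n p) := by
  refine ⟨fun e he => ?_, fun e he f hf => ?_, fun f hf h => ?_⟩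
  · obtain ⟨q, hq, rfl⟩ := mem_triang.1 he
    exact (isDiagonal_iff _).2 ⟨q, hq.1, rfl⟩
  · obtain ⟨q, hq, rfl⟩ := mem_triang.1 he
    obtain ⟨r, hr, rfl⟩ := mem_triang.1 hf
    rw [crosses_toPair_iff hq.1 hr.1]
    exact not_labelCross hq hr
  · obtain ⟨q, hq, rfl⟩ := (isDiagonal_iff _).1 hf
    rw [toPair_mem_triang hq]
    by_contra hcon
    obtain ⟨r, hr, hrq⟩ := exists_labelCross hp hq hcon
    exact h _ (mem_triang.2 ⟨r, hr, rfl⟩) ((crosses_toPair_iff hr.1 hq).2 hrq)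

theorem triang_next (hn : 4 ≤ n) {p : ℕ × ℕ} (hp : Valid n p) :
    triang n (next n p) =
      insert (toPair n (next n p)) ((triang n p).erase (toPair n (removed n (next n p)))) := by
  have hnext := valid_next hn hp
  have hrem := (mem_removed hn hp).1
  ext g
  rw [Finset.mem_insert, Finset.mem_erase]
  constructor
  · intro hg
    obtain ⟨q, hq, rfl⟩ := mem_triang.1 hg
    rcases (mem_next_iff hn hp q).1 hq with rfl | ⟨h1, h2⟩
    · exact Or.inl rfl
    · exact Or.inr ⟨fun h => h1 (toPair_injOn h2.1 hrem h), mem_triang.2 ⟨q, h2, rfl⟩⟩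
  · rintro (rfl | ⟨h1, h2⟩)
    · exact (toPair_mem_triang hnext).2 (mem_self hnext)
    · obtain ⟨q, hq, rfl⟩ := mem_triang.1 h2
      exact mem_triang.2 ⟨q, (mem_next_iff hn hp q).2
        (Or.inr ⟨fun h => h1 (congrArg _ h), hq⟩), rfl⟩

theorem enters_iff (hn : 4 ≤ n) {p q : ℕ × ℕ} (hp : Valid n p) (hq : Valid n q) :
    toPair n q ∈ triang n (next n p) ∧ toPair n q ∉ triang n p ↔ next n p = q := by
  rw [toPair_mem_triang hq, toPair_mem_triang hq, mem_next_iff hn hp]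
  constructor
  · rintro ⟨rfl | h, h'⟩
    · rfl
    · exact absurd h.2 h'
  · rintro rfl
    exact ⟨Or.inl rfl, not_mem_next hn hp⟩

end RainbowCycle

open RainbowCycle

/-- For every `n ≥ 4`, the flip graph of triangulations of a convex `n`-gon
contains a 1-rainbow cycle; it has length `C(n,2) - n`. -/
theorem triangulations_one_rainbow_cycle (n : ℕ) (hn : 4 ≤ n) :
    ∃ V : ℕ → Finset (Sym2 (ZMod n)),
      IsRainbowCycleT n 1 (n.choose 2 - n) V := by
  have : NeZero n := ⟨by omega⟩
  have hL := remaining_first hn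
  refine ⟨fun t => triang n (seq n t), by omega, fun t => ?_, fun s hs t ht h => ?_,
    fun t => isTriangulation_triang (valid_seq hn t), fun t => ?_, fun g hg => ?_⟩
  · exact congrArg (triang n) (seq_add_period hn t)
  · exact seq_injOn hn hs ht (triang_injOn (valid_seq hn s) (valid_seq hn t) h)
  · have hv := valid_seq hn t
    refine ⟨toPair n (removed n (next n (seq n t))), toPair n (next n (seq n t)),
      mem_triang.2 ⟨_, mem_removed hn hv, rfl⟩, ?_, ?_⟩
    · rw [toPair_mem_triang (valid_next hn hv)]
      exact not_mem_next hn hv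
    · simp only [seq_succ]
      convert triang_next hn hv
  · obtain ⟨q, hq, rfl⟩ := (isDiagonal_iff g).1 hg
    obtain ⟨t, ht, huniq⟩ := existsUnique_seq_succ_eq hn hq
    rw [Finset.card_eq_one]
    refine ⟨t, Finset.ext fun s => ?_⟩
    simp only [Finset.mem_filter, Finset.mem_range, Finset.mem_singleton]
    rw [seq_succ,
      enters_iff hn (valid_seq hn s) hq, ← seq_succ]
    exact ⟨fun h => (huniq s h.1).1 h.2, fun h => ⟨h ▸ ht, (huniq s (h ▸ ht)).2 h⟩⟩
end

section
/- For every integer n ≥ 7, the flip graph of triangulations G_n^T of a convex n-gon contains a 2-rainbow cycle, i.e., a directed cycle of length 2·(C(n,2) − n) visiting no triangulation twice, along which every diagonal in E_n appears as an arc label exactly twice. -/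
namespace FanCycle

variable {n : ℕ} {i : ZMod n}

theorem add_natCast_inj {u v : ℕ} (hu : u < n) (hv : v < n) :
    i + (u : ZMod n) = i + (v : ZMod n) ↔ u = v := by
  rw [add_right_inj, ZMod.natCast_eq_natCast_iff', Nat.mod_eq_of_lt hu, Nat.mod_eq_of_lt hv]

theorem exists_add_natCast [NeZero n] (i x : ZMod n) : ∃ u < n, x = i + (u : ZMod n) :=
  ⟨(x - i).val, ZMod.val_lt _, by simp⟩

theorem val_add_sub_add {u w : ℕ} (hu : u < n) (hw : w < n) :
    ((i + (w : ZMod n)) - (i + (u : ZMod n))).val = if u ≤ w then w - u else w + n - u := by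
  rw [add_sub_add_left_eq_sub]
  split_ifs with h
  · rw [← Nat.cast_sub h, ZMod.val_natCast, Nat.mod_eq_of_lt (by omega)]
  · have : (w : ZMod n) - u = ((w + n - u : ℕ) : ZMod n) := by
      rw [Nat.cast_sub (by omega)]; simp
    rw [this, ZMod.val_natCast, Nat.mod_eq_of_lt (by omega)]

theorem strictBtw_iff {u w v : ℕ} (hu : u < n) (hw : w < n) (hv : v < n) :
    StrictBtw n (i + (u : ZMod n)) (i + (w : ZMod n)) (i + (v : ZMod n)) ↔
      (u < w ∧ w < v) ∨ (w < v ∧ v < u) ∨ (v < u ∧ u < w) := by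
  rw [StrictBtw, val_add_sub_add hu hw, val_add_sub_add hu hv]
  split_ifs <;> omega

theorem mk_inj {u v w z : ℕ} (huv : u < v) (hv : v < n) (hwz : w < z) (hz : z < n) :
    s(i + (u : ZMod n), i + (v : ZMod n)) = s(i + (w : ZMod n), i + (z : ZMod n)) ↔
      u = w ∧ v = z := by
  rw [Sym2.eq_iff, add_natCast_inj (by omega) (by omega), add_natCast_inj (by omega) (by omega),
    add_natCast_inj (by omega) (by omega), add_natCast_inj (by omega) (by omega)]
  omega

theorem crosses_iff {u v w z : ℕ} (huv : u < v) (hv : v < n) (hwz : w < z) (hz : z < n) :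
    Crosses n s(i + (u : ZMod n), i + (v : ZMod n)) s(i + (w : ZMod n), i + (z : ZMod n)) ↔
      (u < w ∧ w < v ∧ v < z) ∨ (w < u ∧ u < z ∧ z < v) := by
  have hu : u < n := by omega
  have hw : w < n := by omega
  constructor
  · rintro ⟨a, b, c, d, h₁, h₂, -, -, -, -, -, -, h₃, h₄⟩
    rw [Sym2.eq_iff] at h₁ h₂
    rcases h₁ with ⟨rfl, rfl⟩ | ⟨rfl, rfl⟩ <;> rcases h₂ with ⟨rfl, rfl⟩ | ⟨rfl, rfl⟩ <;>
    · rw [strictBtw_iff (by assumption) (by assumption) (by assumption)] at h₃ h₄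
      omega
  · rintro (h | h)
    · refine ⟨_, _, _, _, rfl, rfl, ?_⟩
      simp only [ne_eq, add_natCast_inj hu hv, add_natCast_inj hu hw, add_natCast_inj hu hz,
        add_natCast_inj hv hw, add_natCast_inj hv hz, add_natCast_inj hw hz,
        strictBtw_iff hu hw hv, strictBtw_iff hv hz hu]
      omega
    · refine ⟨_, _, _, _, rfl, Sym2.eq_swap, ?_⟩
      simp only [ne_eq, add_natCast_inj hu hv, add_natCast_inj hu hw, add_natCast_inj hu hz,
        add_natCast_inj hv hw, add_natCast_inj hv hz, add_natCast_inj hz hw,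
        strictBtw_iff hu hz hv, strictBtw_iff hv hw hu]
      omega

theorem isDiagonal_iff {u v : ℕ} (huv : u < v) (hv : v < n) :
    IsDiagonal n s(i + (u : ZMod n), i + (v : ZMod n)) ↔ u + 2 ≤ v ∧ v + 2 ≤ u + n := by
  have h₁ : i + (v : ZMod n) = i + (u : ZMod n) + 1 ↔ v = u + 1 := by
    rw [add_assoc, ← Nat.cast_add_one, add_natCast_inj hv (by omega)]
  have h₂ : i + (u : ZMod n) = i + (v : ZMod n) + 1 ↔ v + 1 = u + n := by
    rw [add_assoc, ← Nat.cast_add_one, add_right_inj, ZMod.natCast_eq_natCast_iff',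
      Nat.mod_eq_of_lt (huv.trans hv)]
    rcases (Nat.succ_le_of_lt hv).lt_or_eq with h | h
    · rw [Nat.mod_eq_of_lt h]; omega
    · rw [show v + 1 = n from h, Nat.mod_self]; omega
  have h₃ := add_natCast_inj (i := i) (huv.trans hv) hv
  constructor
  · rintro ⟨a, b, h, -, h₄, h₅⟩
    rw [Sym2.eq_iff] at h
    rcases h with ⟨rfl, rfl⟩ | ⟨rfl, rfl⟩ <;> simp only [ne_eq, h₁, h₂] at h₄ h₅ <;> omega
  · intro h
    refine ⟨_, _, rfl, ?_⟩
    rw [ne_eq, ne_eq, ne_eq, h₁, h₂, h₃]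
    omega

theorem exists_mk_of_isDiagonal [NeZero n] {e : Sym2 (ZMod n)} (h : IsDiagonal n e)
    (i : ZMod n) :
    ∃ u v : ℕ, u < v ∧ v < n ∧ e = s(i + (u : ZMod n), i + (v : ZMod n)) := by
  obtain ⟨a, b, rfl, hab, -, -⟩ := h
  obtain ⟨u, hu, rfl⟩ := exists_add_natCast i a
  obtain ⟨v, hv, rfl⟩ := exists_add_natCast i b
  rw [ne_eq, add_natCast_inj hu hv] at hab
  rcases lt_or_gt_of_ne hab with h | h
  · exact ⟨u, v, h, hv, rfl⟩
  · exact ⟨v, u, h, hu, Sym2.eq_swap⟩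

/-- The triangulation reached from the fan with apex `i` after `a` of the `n - 3` flips
that lead to the fan with apex `i + 1`. -/
def doubleFan (n : ℕ) (i : ZMod n) (a : ℕ) : Finset (Sym2 (ZMod n)) :=
  (Finset.Ico 3 (a + 3)).image (fun v : ℕ => s(i + (1 : ℕ), i + (v : ZMod n))) ∪
  (Finset.Ico (a + 2) (n - 1)).image (fun v : ℕ => s(i + (0 : ℕ), i + (v : ZMod n)))

theorem mem_doubleFan {a : ℕ} {e : Sym2 (ZMod n)} :
    e ∈ doubleFan n i a ↔
      (∃ v, (3 ≤ v ∧ v < a + 3) ∧ s(i + (1 : ℕ), i + (v : ZMod n)) = e) ∨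
      (∃ v, (a + 2 ≤ v ∧ v < n - 1) ∧ s(i + (0 : ℕ), i + (v : ZMod n)) = e) := by
  simp only [doubleFan, Finset.mem_union, Finset.mem_image, Finset.mem_Ico]

theorem mk_mem_doubleFan {a u v : ℕ} (ha : a + 3 ≤ n) (huv : u < v) (hv : v < n) :
    s(i + (u : ZMod n), i + (v : ZMod n)) ∈ doubleFan n i a ↔
      (u = 1 ∧ 3 ≤ v ∧ v < a + 3) ∨ (u = 0 ∧ a + 2 ≤ v ∧ v + 1 < n) := by
  rw [mem_doubleFan]
  constructor
  · rintro (⟨w, hw, h⟩ | ⟨w, hw, h⟩) <;> rw [mk_inj (by omega) (by omega) huv hv] at h <;> omega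
  · rintro (⟨rfl, h⟩ | ⟨rfl, h⟩)
    · exact Or.inl ⟨v, h, rfl⟩
    · exact Or.inr ⟨v, by omega, rfl⟩

theorem isDiagonal_of_mem_doubleFan {a : ℕ} (ha : a + 3 ≤ n) {e : Sym2 (ZMod n)}
    (he : e ∈ doubleFan n i a) : IsDiagonal n e := by
  obtain ⟨v, hv, rfl⟩ | ⟨v, hv, rfl⟩ := mem_doubleFan.1 he <;>
    rw [isDiagonal_iff (by omega) (by omega)] <;> omega

theorem isTriangulation_doubleFan [NeZero n] {a : ℕ} (ha : a + 3 ≤ n) :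
    IsTriangulation n (doubleFan n i a) := by
  refine ⟨fun e he => isDiagonal_of_mem_doubleFan ha he, ?_, ?_⟩
  · intro e he f hf
    obtain ⟨u, v, huv, hv, rfl⟩ := exists_mk_of_isDiagonal (isDiagonal_of_mem_doubleFan ha he) i
    obtain ⟨w, z, hwz, hz, rfl⟩ := exists_mk_of_isDiagonal (isDiagonal_of_mem_doubleFan ha hf) i
    rw [mk_mem_doubleFan ha (by assumption) (by assumption)] at he hf
    rw [crosses_iff huv hv hwz hz]
    omega
  · intro f hf hcross
    obtain ⟨w, z, hwz, hz, rfl⟩ := exists_mk_of_isDiagonal hf i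
    rw [isDiagonal_iff hwz hz] at hf
    have key : ∀ u v, u < v → v < n →
        ((u = 1 ∧ 3 ≤ v ∧ v < a + 3) ∨ (u = 0 ∧ a + 2 ≤ v ∧ v + 1 < n)) →
        ¬ ((u < w ∧ w < v ∧ v < z) ∨ (w < u ∧ u < z ∧ z < v)) := by
      intro u v huv hv h
      rw [← crosses_iff (i := i) huv hv hwz hz]
      exact hcross _ ((mk_mem_doubleFan ha huv hv).2 h)
    rw [mk_mem_doubleFan ha hwz hz]
    by_contra hmem
    have h₁ := key 1 (z + 1)
    have h₂ := key 0 (z - 1)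
    have h₃ := key 1 (w + 1)
    have h₄ := key 0 (w + 1)
    omega

theorem doubleFan_succ [NeZero n] {a : ℕ} (ha : a + 3 < n) :
    doubleFan n i (a + 1) =
      insert s(i + (1 : ℕ), i + ((a + 3 : ℕ) : ZMod n))
        ((doubleFan n i a).erase s(i + (0 : ℕ), i + ((a + 2 : ℕ) : ZMod n))) := by
  have hdiag : ∀ e, e ∈ doubleFan n i (a + 1) ∨ e ∈ insert s(i + (1 : ℕ),
      i + ((a + 3 : ℕ) : ZMod n)) ((doubleFan n i a).erase
        s(i + (0 : ℕ), i + ((a + 2 : ℕ) : ZMod n))) → IsDiagonal n e := by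
    rintro e (h | h)
    · exact isDiagonal_of_mem_doubleFan (by omega) h
    · rcases Finset.mem_insert.1 h with rfl | h
      · rw [isDiagonal_iff (by omega) (by omega)]; omega
      · exact isDiagonal_of_mem_doubleFan ha.le (Finset.mem_of_mem_erase h)
  ext e
  by_cases he : IsDiagonal n e
  · obtain ⟨u, v, huv, hv, rfl⟩ := exists_mk_of_isDiagonal he i
    rw [Finset.mem_insert, Finset.mem_erase, mk_mem_doubleFan (by omega) huv hv,
      mk_mem_doubleFan (by omega) huv hv, ne_eq, mk_inj huv hv (by omega) (by omega),
      mk_inj huv hv (by omega) (by omega)]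
    omega
  · exact ⟨fun h => (he (hdiag e (.inl h))).elim, fun h => (he (hdiag e (.inr h))).elim⟩

theorem doubleFan_last (hn : 3 ≤ n) : doubleFan n i (n - 3) = doubleFan n (i + 1) 0 := by
  ext e
  rw [mem_doubleFan, mem_doubleFan]
  constructor
  · rintro (⟨v, hv, rfl⟩ | ⟨v, hv, rfl⟩)
    · refine Or.inr ⟨v - 1, by omega, ?_⟩
      rw [Nat.cast_sub (by omega)]
      refine congrArg₂ (fun x y => s(x, y)) ?_ ?_ <;> push_cast <;> ring
    · omega
  · rintro (⟨v, hv, rfl⟩ | ⟨v, hv, rfl⟩)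
    · omega
    · refine Or.inl ⟨v + 1, by omega, ?_⟩
      refine congrArg₂ (fun x y => s(x, y)) ?_ ?_ <;> push_cast <;> ring

/-- The ears of a double fan. -/
theorem short_mem_doubleFan [NeZero n] (hn : 5 ≤ n) {a : ℕ} (ha : a + 3 < n) {u : ℕ}
    (hu : u < n) :
    s(i + (u : ZMod n), i + (u : ZMod n) + 2) ∈ doubleFan n i a ↔
      u + 2 = n ∨ u = min a 1 := by
  rw [add_assoc, ← Nat.cast_ofNat (n := 2), ← Nat.cast_add]
  by_cases h : u + 2 < n
  · rw [mk_mem_doubleFan ha.le (by omega) h]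
    omega
  · have : ((u + 2 : ℕ) : ZMod n) = ((u + 2 - n : ℕ) : ZMod n) := by
      rw [Nat.cast_sub (by omega)]; simp
    rw [this, Sym2.eq_swap, mk_mem_doubleFan ha.le (by omega) hu]
    omega

theorem doubleFan_inj [NeZero n] (hn : 7 ≤ n) {j : ZMod n} {a b : ℕ} (ha : a + 3 < n)
    (hb : b + 3 < n) (h : doubleFan n i a = doubleFan n j b) : i = j ∧ a = b := by
  have hij : i = j := by
    obtain ⟨d, hd, rfl⟩ := exists_add_natCast i j
    have key : ∀ u < n, ∀ w < n, (u = d + w ∨ u + n = d + w) →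
        ((u + 2 = n ∨ u = min a 1) ↔ (w + 2 = n ∨ w = min b 1)) := by
      intro u hu w hw huw
      rw [← short_mem_doubleFan (i := i) (by omega) ha hu, h,
        ← short_mem_doubleFan (i := i + (d : ZMod n)) (by omega) hb hw]
      have : (u : ZMod n) = (d : ZMod n) + (w : ZMod n) := by
        rcases huw with huw | huw
        · rw [huw]; push_cast; rfl
        · simpa using congrArg (Nat.cast : ℕ → ZMod n) huw
      rw [this, ← add_assoc i]
    have h₁ := key (n - 2) (by omega) (if d ≤ n - 2 then n - 2 - d else n - 2 + n - d)
    have h₂ := key (if n ≤ d + (n - 2) then d - 2 else d + (n - 2))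
    have h₃ := h₂ (by split_ifs <;> omega) (n - 2) (by omega) (by split_ifs <;> omega)
    have h₄ := h₁ (by split_ifs <;> omega) (by split_ifs <;> omega)
    have : d = 0 := by
      split_ifs at h₃ h₄ <;> omega
    simp [this]
  subst hij
  refine ⟨rfl, ?_⟩
  have h₁ := mk_mem_doubleFan (i := i) ha.le (u := 0) (v := a + 2) (by omega) (by omega)
  have h₂ := mk_mem_doubleFan (i := i) hb.le (u := 0) (v := a + 2) (by omega) (by omega)
  have h₃ := mk_mem_doubleFan (i := i) ha.le (u := 0) (v := b + 2) (by omega) (by omega)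
  have h₄ := mk_mem_doubleFan (i := i) hb.le (u := 0) (v := b + 2) (by omega) (by omega)
  rw [h] at h₁ h₃
  have h₅ := h₁.symm.trans h₂
  have h₆ := h₃.symm.trans h₄
  omega

/-- The closed walk through the flip graph that visits the fans in cyclic order. -/
def fanCycle (n t : ℕ) : Finset (Sym2 (ZMod n)) :=
  doubleFan n ((t / (n - 3) : ℕ) : ZMod n) (t % (n - 3))

/-- The label of the `t`-th arc of `fanCycle`. -/
def label (n t : ℕ) : Sym2 (ZMod n) :=
  s(((t / (n - 3) : ℕ) : ZMod n) + (1 : ℕ),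
    ((t / (n - 3) : ℕ) : ZMod n) + ((t % (n - 3) + 3 : ℕ) : ZMod n))

theorem fanCycle_succ (hn : 4 ≤ n) (t : ℕ) :
    fanCycle n (t + 1) =
      doubleFan n ((t / (n - 3) : ℕ) : ZMod n) (t % (n - 3) + 1) := by
  have hm := Nat.mod_lt t (show 0 < n - 3 by omega)
  have ht := Nat.div_add_mod t (n - 3)
  set q := t / (n - 3)
  set a := t % (n - 3)
  rw [fanCycle]
  by_cases h : a + 1 < n - 3
  · rw [show t + 1 = (a + 1) + (n - 3) * q by omega, Nat.add_mul_div_left _ _ (by omega),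
      Nat.add_mul_mod_self_left, Nat.div_eq_of_lt h, Nat.mod_eq_of_lt h, zero_add]
  · have h : a + 1 = n - 3 := by omega
    rw [show t + 1 = (n - 3) * (q + 1) by rw [mul_add_one]; omega,
      Nat.mul_div_cancel_left _ (by omega), Nat.mul_mod_right, h, doubleFan_last (by omega),
      Nat.cast_add_one]

theorem fanCycle_flip (hn : 4 ≤ n) (t : ℕ) :
    ∃ e ∈ fanCycle n t, label n t ∉ fanCycle n t ∧
      fanCycle n (t + 1) = insert (label n t) ((fanCycle n t).erase e) := by
  have : NeZero n := ⟨by omega⟩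
  have hm := Nat.mod_lt t (show 0 < n - 3 by omega)
  refine ⟨_, ?_, ?_, (fanCycle_succ hn t).trans (doubleFan_succ (by omega))⟩
  · rw [fanCycle, mk_mem_doubleFan (by omega) (by omega) (by omega)]
    omega
  · rw [fanCycle, label, mk_mem_doubleFan (by omega) (by omega) (by omega)]
    omega

theorem new_mem_iff (hn : 4 ≤ n) (t : ℕ) (g : Sym2 (ZMod n)) :
    g ∈ fanCycle n (t + 1) ∧ g ∉ fanCycle n t ↔ g = label n t := by
  obtain ⟨e, -, hf, h⟩ := fanCycle_flip hn t
  rw [h, Finset.mem_insert, Finset.mem_erase]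
  constructor
  · tauto
  · rintro rfl
    tauto

theorem length_eq (hn : 3 ≤ n) : 2 * (n.choose 2 - n) = n * (n - 3) := by
  obtain ⟨m, rfl⟩ := Nat.exists_eq_add_of_le' hn
  have h : (m + 3).choose 2 * 2 = (m + 3) * (m + 2) := by
    rw [Nat.choose_two_right, Nat.div_mul_cancel (Nat.even_mul_pred_self _).two_dvd]
    rfl
  rw [Nat.mul_sub, mul_comm 2, h, mul_comm 2, ← Nat.mul_sub]
  rfl

theorem eq_of_div_eq_of_mod_eq {k s t : ℕ} (h₁ : s / k = t / k) (h₂ : s % k = t % k) : s = t := by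
  rw [← Nat.div_add_mod s k, ← Nat.div_add_mod t k, h₁, h₂]

theorem natCast_div_inj {s t : ℕ} (hs : s < n * (n - 3)) (ht : t < n * (n - 3))
    (h : ((s / (n - 3) : ℕ) : ZMod n) = ((t / (n - 3) : ℕ) : ZMod n)) :
    s / (n - 3) = t / (n - 3) :=
  (add_natCast_inj (i := 0) (Nat.div_lt_of_lt_mul (by rwa [mul_comm]))
    (Nat.div_lt_of_lt_mul (by rwa [mul_comm]))).1 (by rw [h])

theorem exists_index (hn : 4 ≤ n) (p : ZMod n) {v : ℕ} (h₂ : 2 ≤ v) (hv : v + 2 ≤ n) :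
    ∃ t < n * (n - 3), ((t / (n - 3) : ℕ) : ZMod n) + (1 : ℕ) = p ∧ t % (n - 3) + 2 = v := by
  have : NeZero n := ⟨by omega⟩
  have hlt := ZMod.val_lt (p - 1)
  refine ⟨(v - 2) + (n - 3) * (p - 1).val, ?_, ?_, ?_⟩
  · calc _ < (n - 3) + (n - 3) * (p - 1).val := by omega
      _ = (n - 3) * ((p - 1).val + 1) := by ring
      _ ≤ (n - 3) * n := Nat.mul_le_mul_left _ hlt
      _ = _ := mul_comm _ _
  · rw [Nat.add_mul_div_left _ _ (by omega), Nat.div_eq_of_lt (by omega), zero_add]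
    simp
  · rw [Nat.add_mul_mod_self_left, Nat.mod_eq_of_lt (by omega)]
    omega

theorem label_eq (t : ℕ) {p : ZMod n} {v : ℕ} (h : ((t / (n - 3) : ℕ) : ZMod n) + (1 : ℕ) = p)
    (hv : t % (n - 3) + 2 = v) : label n t = s(p, p + (v : ZMod n)) := by
  rw [label, ← h, ← hv]
  refine congrArg₂ (fun x y => s(x, y)) ?_ ?_ <;> push_cast <;> ring

theorem card_label_eq (hn : 4 ≤ n) {g : Sym2 (ZMod n)} (hg : IsDiagonal n g) :
    ((Finset.range (n * (n - 3))).filter (fun t => g = label n t)).card = 2 := by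
  have : NeZero n := ⟨by omega⟩
  obtain ⟨u, v, huv, hv, rfl⟩ := exists_mk_of_isDiagonal hg 0
  rw [isDiagonal_iff huv hv] at hg
  simp only [zero_add]
  obtain ⟨t₁, ht₁, hp₁, hv₁⟩ := exists_index hn (u : ZMod n) (v := v - u) (by omega) (by omega)
  obtain ⟨t₂, ht₂, hp₂, hv₂⟩ := exists_index hn (v : ZMod n) (v := n + u - v) (by omega) (by omega)
  have e₁ : (u : ZMod n) + ((v - u : ℕ) : ZMod n) = v := by
    rw [Nat.cast_sub huv.le]; ring
  have e₂ : (v : ZMod n) + ((n + u - v : ℕ) : ZMod n) = u := by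
    rw [Nat.cast_sub (by omega)]; simp
  have huv' : (u : ZMod n) ≠ v := fun h =>
    huv.ne ((add_natCast_inj (i := 0) (huv.trans hv) hv).1 (by rw [h]))
  rw [Finset.card_eq_two]
  refine ⟨t₁, t₂, ?_, ?_⟩
  · rintro rfl
    exact huv' (hp₁.symm.trans hp₂)
  ext t
  rw [Finset.mem_filter, Finset.mem_range, Finset.mem_insert, Finset.mem_singleton]
  constructor
  · rintro ⟨ht, h⟩
    have hm := Nat.mod_lt t (show 0 < n - 3 by omega)
    rw [label_eq t rfl rfl] at h
    have aux : ∀ s < n * (n - 3), ∀ (p : ZMod n) (w : ℕ), w + 2 ≤ n →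
        ((s / (n - 3) : ℕ) : ZMod n) + (1 : ℕ) = p → s % (n - 3) + 2 = w →
        p = ((t / (n - 3) : ℕ) : ZMod n) + (1 : ℕ) →
        p + (w : ZMod n) = ((t / (n - 3) : ℕ) : ZMod n) + (1 : ℕ) +
          ((t % (n - 3) + 2 : ℕ) : ZMod n) → t = s := by
      intro s hs p w hwn hp hw hpt hq
      rw [← hpt, add_natCast_inj (by omega) (by omega)] at hq
      exact eq_of_div_eq_of_mod_eq
        (natCast_div_inj ht hs (add_right_cancel (hpt.symm.trans hp.symm))) (by omega)
    rcases Sym2.eq_iff.1 h with ⟨h₁, h₂⟩ | ⟨h₁, h₂⟩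
    · exact Or.inl (aux t₁ ht₁ _ _ (by omega) hp₁ hv₁ h₁ (e₁.trans h₂))
    · exact Or.inr (aux t₂ ht₂ _ _ (by omega) hp₂ hv₂ h₂ (e₂.trans h₁))
  · rintro (rfl | rfl)
    · exact ⟨ht₁, by rw [label_eq t hp₁ hv₁, e₁]⟩
    · exact ⟨ht₂, by rw [label_eq t hp₂ hv₂, e₂, Sym2.eq_swap]⟩

end FanCycle

/-- For every `n ≥ 7`, the flip graph of triangulations of a convex `n`-gon
contains a 2-rainbow cycle; it has length `2·(C(n,2) - n)`. -/
theorem triangulations_two_rainbow_cycle (n : ℕ) (hn : 7 ≤ n) :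
    ∃ V : ℕ → Finset (Sym2 (ZMod n)),
      IsRainbowCycleT n 2 (2 * (n.choose 2 - n)) V := by
  have : NeZero n := ⟨by omega⟩
  have hpos : 0 < n - 3 := by omega
  have hmod : ∀ t, t % (n - 3) + 3 < n := fun t => by
    have := Nat.mod_lt t hpos
    omega
  rw [FanCycle.length_eq (by omega)]
  refine ⟨FanCycle.fanCycle n, Nat.mul_pos (by omega) hpos, fun t => ?_, ?_,
    fun t => FanCycle.isTriangulation_doubleFan (hmod t).le, fun t => ?_, fun g hg => ?_⟩
  · rw [FanCycle.fanCycle, FanCycle.fanCycle, Nat.add_mul_div_right _ _ hpos,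
      Nat.add_mul_mod_self_right, Nat.cast_add, ZMod.natCast_self, add_zero]
  · intro s hs t ht h
    obtain ⟨h₁, h₂⟩ := FanCycle.doubleFan_inj hn (hmod s) (hmod t) h
    exact FanCycle.eq_of_div_eq_of_mod_eq (FanCycle.natCast_div_inj hs ht h₁) h₂
  · obtain ⟨e, he, hf, h⟩ := FanCycle.fanCycle_flip (show 4 ≤ n by omega) t
    exact ⟨e, _, he, hf, h⟩
  · rw [← FanCycle.card_label_eq (by omega) hg]
    simp only [FanCycle.new_mem_iff (show 4 ≤ n by omega)]
end

section
/- For every finite set X of at least 3 points in the Euclidean plane in general position, the flip graph of plane spanning trees G_X^S contains a 1-rainbow cycle, i.e., a directed cycle of length C(|X|,2) visiting no plane spanning tree twice, along which every pair of distinct points of X appears as an arc label exactly once. -/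
/-! Rainbow cycles in the flip graph of plane spanning trees on a point set
`X` in the Euclidean plane in general position. -/

/-- A finite point set in the plane is in general position if no three of its
points are collinear. -/
def GeneralPosition (X : Finset (ℝ × ℝ)) : Prop :=
  ∀ p ∈ X, ∀ q ∈ X, ∀ r ∈ X, p ≠ q → p ≠ r → q ≠ r →
    ¬ Collinear ℝ ({p, q, r} : Set (ℝ × ℝ))

/-- The closed straight-line segment realizing an unordered pair of points. -/
def seg : Sym2 (ℝ × ℝ) → Set (ℝ × ℝ) :=
  Sym2.lift ⟨fun p q => segment ℝ p q, fun p q => segment_symm ℝ p q⟩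

/-- `T` is a plane spanning tree on the finite point set `X`: its edges are
unordered pairs of distinct points of `X`, it is connected and has `|X| - 1`
edges (hence is a spanning tree), and the closed segments realizing two
distinct edges intersect in at most a common endpoint. -/
def IsPlaneSpanningTree (X : Finset (ℝ × ℝ)) (T : Finset (Sym2 (ℝ × ℝ))) : Prop :=
  (∀ e ∈ T, ∃ p q : ℝ × ℝ, e = s(p, q) ∧ p ≠ q ∧ p ∈ X ∧ q ∈ X) ∧
  T.card = X.card - 1 ∧
  (∀ p ∈ X, ∀ q ∈ X, Relation.ReflTransGen (fun a b => s(a, b) ∈ T) p q) ∧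
  (∀ e ∈ T, ∀ f ∈ T, e ≠ f → ∀ x ∈ seg e, x ∈ seg f → x ∈ e ∧ x ∈ f)

/-- An `r`-rainbow cycle of length `L` in the flip graph `G_X^S` of plane
spanning trees on `X`, encoded as an `L`-periodic sequence `V` of plane
spanning trees: consecutive trees differ in a flip (removing one edge `e` and
inserting another edge `f`, which is the label of the arc), no tree is visited
twice within a period, and every pair of distinct points of `X` appears as an
arc label (i.e. enters the tree) exactly `r` times per period. -/
def IsRainbowCycleS (X : Finset (ℝ × ℝ)) (r L : ℕ)
    (V : ℕ → Finset (Sym2 (ℝ × ℝ))) : Prop :=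
  0 < L ∧
  (∀ i, V (i + L) = V i) ∧
  (∀ i < L, ∀ j < L, V i = V j → i = j) ∧
  (∀ i, IsPlaneSpanningTree X (V i)) ∧
  (∀ i, ∃ e f, e ∈ V i ∧ f ∉ V i ∧ V (i + 1) = insert f ((V i).erase e)) ∧
  (∀ p ∈ X, ∀ q ∈ X, p ≠ q →
    ((Finset.range L).filter (fun i => s(p, q) ∈ V (i + 1) ∧ s(p, q) ∉ V i)).card = r)

open Finset in
/-- A rainbow cycle arises from a chain of exchanges each raising the weight of one element by one,
closed up by an exchange of the heaviest element for the lightest one. -/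
theorem exists_cycle_of_weight_chain {E : Type*} [DecidableEq E] (P : Finset E → Prop)
    (U : Finset E) (hU : ∀ T, P T → T ⊆ U) (w : E → ℕ) (hw : Set.InjOn w U)
    (hwlt : ∀ e ∈ U, w e < U.card) {A B : Finset E} (hA : P A)
    (hAB : Relation.ReflTransGen (fun T T' => P T' ∧
      ∃ e f, e ∈ T ∧ f ∉ T ∧ T' = insert f (T.erase e) ∧ w f = w e + 1) A B)
    {e₀ f₀ : E} (he₀ : e₀ ∈ B) (hf₀ : f₀ ∉ B) (hBA : A = insert f₀ (B.erase e₀))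
    (hwe₀ : w e₀ + 1 = U.card) (hwf₀ : w f₀ = 0) :
    ∃ V : ℕ → Finset E, (∀ i, V (i + U.card) = V i) ∧
      (∀ i < U.card, ∀ j < U.card, V i = V j → i = j) ∧ (∀ i, P (V i)) ∧
      (∀ i, ∃ e f, e ∈ V i ∧ f ∉ V i ∧ V (i + 1) = insert f ((V i).erase e)) ∧
      ∀ e ∈ U, ((range U.card).filter (fun i => e ∈ V (i + 1) ∧ e ∉ V i)).card = 1 := by
  obtain ⟨m, V, hV0, hVm, hV⟩ : ∃ (m : ℕ) (V : ℕ → Finset E), V 0 = A ∧ V m = B ∧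
      ∀ i < m, P (V (i + 1)) ∧ ∃ e f, e ∈ V i ∧ f ∉ V i ∧
        V (i + 1) = insert f ((V i).erase e) ∧ w f = w e + 1 := by
    clear hBA he₀ hf₀
    induction hAB with
    | refl => exact ⟨0, fun _ => A, rfl, rfl, by simp⟩
    | @tail B C _ hBC ih =>
      obtain ⟨m, V, h0, hm, hV⟩ := ih
      refine ⟨m + 1, fun i => if i ≤ m then V i else C, by simp [h0], by simp, fun i hi => ?_⟩
      rcases Nat.lt_succ_iff_lt_or_eq.mp hi with h | rfl
      · have h1 : i + 1 ≤ m := h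
        simpa [h1, h.le] using hV i h
      · simpa [hm] using hBC
  have hsum : ∀ (T : Finset E) (e f : E), e ∈ T → f ∉ T →
      ∑ x ∈ insert f (T.erase e), w x + w e = ∑ x ∈ T, w x + w f := by
    intro T e f he hf
    rw [sum_insert (fun h => hf (mem_of_mem_erase h)), ← sum_erase_add T w he]
    ring
  have hW : ∀ i ≤ m, ∑ x ∈ V i, w x = ∑ x ∈ A, w x + i := by
    intro i
    induction i with
    | zero => intro _; simp [hV0]
    | succ i ih =>
      intro hi
      obtain ⟨-, e, f, he, hf, h, hwt⟩ := hV i hi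
      have := hsum _ e f he hf
      have := ih (by omega)
      rw [h]
      omega
  have hm : m + 1 = U.card := by
    have h1 := hW m le_rfl
    have h2 := hsum B e₀ f₀ he₀ hf₀
    rw [hVm] at h1
    rw [← hBA] at h2
    omega
  have hPV : ∀ i ≤ m, P (V i) := by
    rintro (_ | i) hi
    · rwa [hV0]
    · exact (hV i hi).1
  rw [← hm] at hwlt hwe₀ ⊢
  have hmod : ∀ i, i % (m + 1) ≤ m := fun i => Nat.lt_succ_iff.mp (Nat.mod_lt _ (by omega))
  have hstep : ∀ i, ∃ e f, e ∈ V (i % (m + 1)) ∧ f ∉ V (i % (m + 1)) ∧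
      V ((i + 1) % (m + 1)) = insert f ((V (i % (m + 1))).erase e) ∧
      (w f = w e + 1 ∨ w e = m) := by
    intro i
    rcases (hmod i).lt_or_eq with h | h
    · obtain ⟨-, e, f, he, hf, h', hwt⟩ := hV _ h
      refine ⟨e, f, he, hf, ?_, .inl hwt⟩
      rw [← h', Nat.add_mod, Nat.mod_eq_of_lt (a := i % (m + 1) + 1 % (m + 1))]
      · rw [Nat.mod_eq_of_lt (a := 1) (by omega)]
      · rw [Nat.mod_eq_of_lt (a := 1) (by omega)]; omega
    · refine ⟨e₀, f₀, ?_, ?_, ?_, .inr (by omega)⟩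
      · rwa [h, hVm]
      · rwa [h, hVm]
      · have : (i + 1) % (m + 1) = 0 := by
          have := Nat.mod_add_div i (m + 1)
          rw [h] at this
          rw [← this, show m + (m + 1) * (i / (m + 1)) + 1 = (m + 1) * (i / (m + 1) + 1) by ring]
          simp
        rw [this, hV0, h, hVm, hBA]
  have hcross : ∀ (Q : ℕ → Prop) (s t : ℕ), s ≤ t → Q s → ¬ Q t → ∃ i, Q i ∧ ¬ Q (i + 1) := by
    intro Q s t hst hs ht
    by_contra! h
    exact ht (Nat.le_induction hs (fun k _ hk => h k hk) t hst)
  have hnonconst : ∀ c ≤ m, ∀ e ∈ U, w e = c →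
      (∃ i, e ∈ V (i % (m + 1)) ∧ e ∉ V ((i + 1) % (m + 1))) ∧
        ∃ i, e ∈ V ((i + 1) % (m + 1)) ∧ e ∉ V (i % (m + 1)) := by
    intro c hc e heU hwe
    suffices h : ∃ i, e ∈ V ((i + 1) % (m + 1)) ∧ e ∉ V (i % (m + 1)) by
      refine ⟨?_, h⟩
      obtain ⟨i, hi1, hi2⟩ := h
      refine hcross (fun i => e ∈ V (i % (m + 1))) (i + 1) (i + (m + 1)) (by omega) hi1 ?_
      simpa using hi2
    induction c generalizing e with
    | zero =>
      have hA0 : A ⊆ U := hU _ hA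
      have : e = f₀ := hw heU (hA0 (by simp [hBA])) (by omega)
      refine ⟨m, ?_, ?_⟩
      · simp [hV0, hBA, this]
      · rwa [Nat.mod_eq_of_lt (by omega), hVm, this]
    | succ c ih =>
      obtain ⟨e', he'U, hwe'⟩ : ∃ e' ∈ U, w e' = c := by
        have himg : U.image w = range (m + 1) :=
          eq_of_subset_of_card_le (fun x hx => by
            obtain ⟨y, hy, rfl⟩ := mem_image.mp hx
            exact mem_range.mpr (hwlt y hy)) (by rw [card_image_of_injOn hw]; simp [hm])
        have : c ∈ U.image w := by rw [himg]; exact mem_range.mpr (by omega)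
        simpa using this
      obtain ⟨i, hi1, hi2⟩ := ih (by omega) e' he'U hwe'
      obtain ⟨j, hj1, hj2⟩ := hcross (fun i => e' ∈ V (i % (m + 1))) (i + 1) (i + (m + 1))
        (by omega) hi1 (by simpa using hi2)
      obtain ⟨a, f, ha, hf, hs, hwt⟩ := hstep j
      have hae : e' = a := by
        by_contra hne
        exact hj2 (by rw [hs]; exact mem_insert_of_mem (mem_erase.mpr ⟨hne, hj1⟩))
      subst hae
      have hfU : f ∈ U := hU _ (hPV _ (hmod (j + 1))) (by rw [hs]; exact mem_insert_self _ _)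
      have : e = f := hw heU hfU (by omega)
      subst this
      exact ⟨j, by rw [hs]; exact mem_insert_self _ _, hf⟩
  refine ⟨fun i => V (i % (m + 1)), by simp, ?_, fun i => hPV _ (hmod i), ?_, ?_⟩
  · intro i hi j hj hij
    have h1 := hW i (by omega)
    have h2 := hW j (by omega)
    simp only [Nat.mod_eq_of_lt hi, Nat.mod_eq_of_lt hj] at hij
    rw [hij] at h1
    omega
  · intro i
    obtain ⟨e, f, he, hf, h, -⟩ := hstep i
    exact ⟨e, f, he, hf, h⟩
  · set C : E → Finset ℕ := fun e =>
      (range (m + 1)).filter (fun i => e ∈ V ((i + 1) % (m + 1)) ∧ e ∉ V (i % (m + 1))) with hC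
    have hpos : ∀ e ∈ U, 1 ≤ (C e).card := by
      intro e he
      obtain ⟨-, i, hi1, hi2⟩ := hnonconst _ (Nat.lt_succ_iff.mp (hwlt e he)) e he rfl
      refine card_pos.mpr ⟨i % (m + 1), ?_⟩
      simp only [hC, mem_filter, mem_range]
      refine ⟨Nat.mod_lt _ (by omega), ?_, ?_⟩
      · simpa using hi1
      · simpa using hi2
    have hdisj : (U : Set E).PairwiseDisjoint C := by
      intro e _ e' _ hne
      rw [Function.onFun, disjoint_left]
      intro i hi hi'
      simp only [hC, mem_filter] at hi hi'
      obtain ⟨a, f, -, -, h, -⟩ := hstep i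
      have key : ∀ x, x ∈ V ((i + 1) % (m + 1)) → x ∉ V (i % (m + 1)) → x = f := by
        intro x hx hx'
        rw [h, mem_insert] at hx
        exact hx.resolve_right (fun h => hx' (mem_of_mem_erase h))
      exact hne ((key e hi.2.1 hi.2.2).trans (key e' hi'.2.1 hi'.2.2).symm)
    have htotal : ∑ e ∈ U, (C e).card ≤ ∑ e ∈ U, 1 := by
      rw [← card_biUnion hdisj]
      calc _ ≤ (range (m + 1)).card :=
            card_le_card (biUnion_subset.mpr fun e _ => filter_subset _ _)
        _ = _ := by simp [hm]
    have := (sum_eq_sum_iff_of_le hpos).mp (le_antisymm (sum_le_sum hpos) htotal)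
    intro e he
    exact (this e he).symm

/-- The cross product of `b - a` and `c - a`, positive when `a, b, c` turn counterclockwise. -/
def orient (a b c : ℝ × ℝ) : ℝ :=
  (b.1 - a.1) * (c.2 - a.2) - (b.2 - a.2) * (c.1 - a.1)

theorem collinear_of_orient_eq_zero {a b c : ℝ × ℝ} (hab : a ≠ b) (h : orient a b c = 0) :
    Collinear ℝ ({a, b, c} : Set (ℝ × ℝ)) := by
  rw [collinear_iff_of_mem (p₀ := a) (by simp)]
  refine ⟨b - a, ?_⟩
  unfold orient at h
  simp only [Set.mem_insert_iff, Set.mem_singleton_iff, forall_eq_or_imp, forall_eq]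
  refine ⟨⟨0, by simp⟩, ⟨1, by simp⟩, ?_⟩
  by_cases h1 : b.1 - a.1 = 0
  · have h2 : b.2 - a.2 ≠ 0 := fun h2 => hab (Prod.ext (by linarith) (by linarith))
    refine ⟨(c.2 - a.2) / (b.2 - a.2), Prod.ext ?_ ?_⟩
    · have : c.1 - a.1 = 0 := by
        rw [h1] at h
        rcases mul_eq_zero.mp (show (b.2 - a.2) * (c.1 - a.1) = 0 by linarith) with h | h
        · exact absurd h h2
        · exact h
      simp [h1]
      linarith
    · simp
      field_simp
      ring
  · refine ⟨(c.1 - a.1) / (b.1 - a.1), Prod.ext ?_ ?_⟩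
    · simp
      field_simp
      ring
    · simp
      field_simp
      linarith

theorem GeneralPosition.orient_ne_zero {X : Finset (ℝ × ℝ)} (hX : GeneralPosition X)
    {a b c : ℝ × ℝ} (ha : a ∈ X) (hb : b ∈ X) (hc : c ∈ X) (hab : a ≠ b) (hac : a ≠ c)
    (hbc : b ≠ c) : orient a b c ≠ 0 := fun h =>
  hX a ha b hb c hc hab hac hbc (collinear_of_orient_eq_zero hab h)

/-- `p 0, …, p (|X| - 1)` lists the points of `X` without repetition, and all points after the
first one are sorted counterclockwise around it, within an angle less than `π`. -/
structure IsRadialOrder (X : Finset (ℝ × ℝ)) (p : ℕ → ℝ × ℝ) : Prop where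
  injOn : Set.InjOn p (Set.Iio X.card)
  mem : ∀ i < X.card, p i ∈ X
  surj : ∀ x ∈ X, ∃ i < X.card, p i = x
  orient_pos : ∀ j k, 1 ≤ j → j < k → k < X.card → 0 < orient (p 0) (p j) (p k)

theorem GeneralPosition.exists_isRadialOrder {X : Finset (ℝ × ℝ)} (hX : GeneralPosition X)
    (hne : X.Nonempty) : ∃ p : ℕ → ℝ × ℝ, IsRadialOrder X p := by
  classical
  obtain ⟨o, ho, hmin⟩ := X.exists_min_image toLex hne
  have hright : ∀ x ∈ X, x ≠ o → o.1 < x.1 ∨ o.1 = x.1 ∧ o.2 < x.2 := by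
    intro x hx hxo
    have h := lt_of_le_of_ne (hmin x hx) (fun h => hxo (toLex.injective h.symm))
    exact Prod.Lex.toLex_lt_toLex.mp h
  let key : ℝ × ℝ → WithTop ℝ := fun x =>
    if x.1 = o.1 then ⊤ else (((x.2 - o.2) / (x.1 - o.1) : ℝ) : WithTop ℝ)
  have hkey : ∀ x ∈ X, ∀ y ∈ X, x ≠ o → y ≠ o → key x ≤ key y → 0 ≤ orient o x y := by
    intro x hx y hy hxo hyo hxy
    simp only [key] at hxy
    unfold orient
    rcases hright x hx hxo with h1 | ⟨h1, h1'⟩ <;> rcases hright y hy hyo with h2 | ⟨h2, h2'⟩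
    · rw [if_neg h1.ne', if_neg h2.ne', WithTop.coe_le_coe,
        div_le_div_iff₀ (by linarith) (by linarith)] at hxy
      linarith
    · rw [← h2]
      nlinarith
    · rw [if_pos h1.symm, if_neg h2.ne'] at hxy
      simp at hxy
    · rw [← h1, ← h2]
      simp
  set Y := X.erase o with hY
  have hcard : Y.card + 1 = X.card := Finset.card_erase_add_one ho
  let f : Fin Y.card ≃ Y := Y.equivFin.symm
  let σ := Tuple.sort (fun i => key (f i))
  have hmono : Monotone ((fun i => key (f i)) ∘ σ) := Tuple.monotone_sort _
  let q : Fin Y.card → ℝ × ℝ := fun i => f (σ i)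
  have hqinj : Function.Injective q := Subtype.val_injective.comp (f.injective.comp σ.injective)
  have hqmem : ∀ i, q i ∈ Y := fun i => (f (σ i)).2
  have hqsurj : ∀ y ∈ Y, ∃ i, q i = y := fun y hy =>
    ⟨σ.symm (f.symm ⟨y, hy⟩), by simp [q]⟩
  let p : ℕ → ℝ × ℝ := fun i => if h : i - 1 < Y.card ∧ i ≠ 0 then q ⟨i - 1, h.1⟩ else o
  have hp0 : p 0 = o := by simp [p]
  have hp : ∀ i, ∀ _ : 1 ≤ i, ∀ h : i < X.card, p i = q ⟨i - 1, by omega⟩ := fun i hi h => by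
    simp only [p]
    exact dif_pos ⟨by omega, by omega⟩
  have hpY : ∀ i, 1 ≤ i → i < X.card → p i ∈ Y := fun i hi h => by
    rw [hp i hi h]; exact hqmem _
  have hinj : Set.InjOn p (Set.Iio X.card) := by
    intro i hi j hj hij
    simp only [Set.mem_Iio] at hi hj
    rcases Nat.eq_zero_or_pos i with rfl | hi0 <;> rcases Nat.eq_zero_or_pos j with rfl | hj0
    · rfl
    · rw [hp0] at hij
      exact absurd (hij ▸ hpY j hj0 hj) (by simp [hY])
    · rw [hp0] at hij
      exact absurd (hij ▸ hpY i hi0 hi) (by simp [hY])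
    · rw [hp i hi0 hi, hp j hj0 hj] at hij
      have := Fin.mk.inj_iff.mp (hqinj hij)
      omega
  refine ⟨p, hinj, ?_, ?_, ?_⟩
  · intro i hi
    rcases Nat.eq_zero_or_pos i with rfl | h
    · rwa [hp0]
    · exact Finset.mem_of_mem_erase (hpY i h hi)
  · intro x hx
    by_cases hxo : x = o
    · exact ⟨0, by omega, by rw [hp0, hxo]⟩
    · obtain ⟨i, hi⟩ := hqsurj x (Finset.mem_erase.mpr ⟨hxo, hx⟩)
      exact ⟨i + 1, by omega, by rw [hp _ (by omega) (by omega), ← hi]; rfl⟩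
  · intro j k hj hjk hk
    have hjY := Finset.mem_erase.mp (hpY j hj (by omega))
    have hkY := Finset.mem_erase.mp (hpY k (by omega) hk)
    rw [hp0]
    refine lt_of_le_of_ne (hkey _ hjY.2 _ hkY.2 hjY.1 hkY.1 ?_) (hX.orient_ne_zero ho hjY.2 hkY.2
      hjY.1.symm hkY.1.symm fun h => hjk.ne (hinj (hjk.trans hk) hk h)).symm
    rw [hp j hj (by omega), hp k (by omega) hk]
    exact hmono (Fin.mk_le_mk.mpr (by omega))

/-- The segments realizing two edges meet in at most a common endpoint. -/
def NonCrossing (e f : Sym2 (ℝ × ℝ)) : Prop :=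
  ∀ x ∈ seg e, x ∈ seg f → x ∈ e ∧ x ∈ f

theorem NonCrossing.symm {e f : Sym2 (ℝ × ℝ)} (h : NonCrossing e f) : NonCrossing f e :=
  fun x hf he => (h x he hf).symm

theorem nonCrossing_of_common_endpoint {a b c : ℝ × ℝ} (h : orient a b c ≠ 0) :
    NonCrossing s(a, b) s(a, c) := by
  rintro x ⟨s, t, hs, ht, hst, rfl⟩ ⟨s', t', hs', ht', hst', hx⟩
  have h1 := congrArg Prod.fst hx
  have h2 := congrArg Prod.snd hx
  simp only [Prod.fst_add, Prod.smul_fst, Prod.snd_add, Prod.smul_snd, smul_eq_mul] at h1 h2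
  obtain rfl : s = 1 - t := by linarith
  obtain rfl : s' = 1 - t' := by linarith
  have : t * orient a b c = 0 := by
    unfold orient
    linear_combination (-(c.2 - a.2)) * h1 + (c.1 - a.1) * h2
  obtain rfl : t = 0 := (mul_eq_zero.mp this).resolve_right h
  simp

theorem nonCrossing_of_orient_pos {o a b c d : ℝ × ℝ} (ha : 0 ≤ orient o a b)
    (hc : 0 < orient o b c) (hd : 0 < orient o b d) : NonCrossing s(a, b) s(c, d) := by
  rintro x ⟨s, t, hs, ht, hst, rfl⟩ ⟨s', t', hs', ht', hst', hx⟩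
  exfalso
  have h1 := congrArg Prod.fst hx
  have h2 := congrArg Prod.snd hx
  simp only [Prod.fst_add, Prod.smul_fst, Prod.snd_add, Prod.smul_snd, smul_eq_mul] at h1 h2
  have hpos : 0 < s' * orient o b c + t' * orient o b d := by
    rcases hs'.eq_or_lt with h | h
    · have : t' = 1 := by linarith
      rw [← h, this]; linarith
    · have := mul_pos h hc
      have := mul_nonneg ht' hd.le
      linarith
  have hneg : s' * orient o b c + t' * orient o b d = - (s * orient o a b) := by
    obtain rfl : s = 1 - t := by linarith
    obtain rfl : s' = 1 - t' := by linarith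
    unfold orient
    linear_combination (-(b.2 - o.2)) * h1 + (b.1 - o.1) * h2
  have := mul_nonneg hs ha
  linarith

theorem nonCrossing_of_orient_neg {o a c d : ℝ × ℝ} (hc : 0 < orient o c a)
    (hd : 0 < orient o d a) : NonCrossing s(o, a) s(c, d) := by
  rintro x ⟨s, t, hs, ht, hst, rfl⟩ ⟨s', t', hs', ht', hst', hx⟩
  exfalso
  have h1 := congrArg Prod.fst hx
  have h2 := congrArg Prod.snd hx
  simp only [Prod.fst_add, Prod.smul_fst, Prod.snd_add, Prod.smul_snd, smul_eq_mul] at h1 h2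
  have hpos : 0 < s' * orient o c a + t' * orient o d a := by
    rcases hs'.eq_or_lt with h | h
    · have : t' = 1 := by linarith
      rw [← h, this]; linarith
    · have := mul_pos h hc
      have := mul_nonneg ht' hd.le
      linarith
  have hzero : s' * orient o c a + t' * orient o d a = 0 := by
    obtain rfl : s = 1 - t := by linarith
    obtain rfl : s' = 1 - t' := by linarith
    unfold orient
    linear_combination ((a.2 - o.2)) * h1 - (a.1 - o.1) * h2
  linarith

/-- The cotangent of the angle at `v` between the directions of `u` and `x`, up to a factor
depending only on `u` and `v`. -/
noncomputable def cotAngle (u v x : ℝ × ℝ) : ℝ :=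
  ((u.1 - v.1) * (x.1 - v.1) + (u.2 - v.2) * (x.2 - v.2)) / |orient v u x|

theorem nonCrossing_of_cotAngle_le {u v x y : ℝ × ℝ} (huv : u ≠ v) (hx : orient v u x ≠ 0)
    (hy : orient v u y ≠ 0) (hxy : orient v x y ≠ 0) (h : cotAngle u v y ≤ cotAngle u v x) :
    NonCrossing s(u, x) s(v, y) := by
  rintro z ⟨s, t, hs, ht, hst, rfl⟩ ⟨s', t', hs', ht', hst', hz⟩
  exfalso
  have h1 := congrArg Prod.fst hz
  have h2 := congrArg Prod.snd hz
  simp only [Prod.fst_add, Prod.smul_fst, Prod.snd_add, Prod.smul_snd, smul_eq_mul] at h1 h2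
  obtain rfl : s = 1 - t := by linarith
  obtain rfl : s' = 1 - t' := by linarith
  have hcross : t' * orient v u y = t * orient v u x := by
    unfold orient
    linear_combination (-(u.2 - v.2)) * h1 + (u.1 - v.1) * h2
  have habs : t' * |orient v u y| = t * |orient v u x| := by
    have := congrArg abs hcross
    rwa [abs_mul, abs_mul, abs_of_nonneg ht', abs_of_nonneg ht] at this
  have hX := abs_pos.mpr hx
  have hY := abs_pos.mpr hy
  have hU : 0 < (u.1 - v.1) ^ 2 + (u.2 - v.2) ^ 2 := by
    by_contra! hle
    have e1 : u.1 - v.1 = 0 := by nlinarith [sq_nonneg (u.1 - v.1), sq_nonneg (u.2 - v.2)]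
    have e2 : u.2 - v.2 = 0 := by nlinarith [sq_nonneg (u.1 - v.1), sq_nonneg (u.2 - v.2)]
    exact huv (Prod.ext (by linarith) (by linarith))
  have hdot : t' * ((u.1 - v.1) * (y.1 - v.1) + (u.2 - v.2) * (y.2 - v.2)) =
      (1 - t) * ((u.1 - v.1) ^ 2 + (u.2 - v.2) ^ 2) +
        t * ((u.1 - v.1) * (x.1 - v.1) + (u.2 - v.2) * (x.2 - v.2)) := by
    linear_combination (u.1 - v.1) * h1 + (u.2 - v.2) * h2
  unfold cotAngle at h
  rw [div_le_div_iff₀ hY hX] at h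
  set A := (u.1 - v.1) * (y.1 - v.1) + (u.2 - v.2) * (y.2 - v.2)
  set B := (u.1 - v.1) * (x.1 - v.1) + (u.2 - v.2) * (x.2 - v.2)
  rcases ht.eq_or_lt with h0 | h0
  · subst h0
    have : t' = 0 := by
      rcases mul_eq_zero.mp (show t' * |orient v u y| = 0 by linarith) with h | h
      · exact h
      · exact absurd h hY.ne'
    rw [this] at hdot
    linarith
  have hstrict : t < 1 := by
    refine lt_of_le_of_ne (by linarith) ?_
    rintro rfl
    refine hxy ?_
    unfold orient
    have e1 : x.1 - v.1 = t' * (y.1 - v.1) := by linarith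
    have e2 : x.2 - v.2 = t' * (y.2 - v.2) := by linarith
    rw [e1, e2]; ring
  have e1 : (t' * A) * |orient v u x| ≤ t' * (B * |orient v u y|) := by
    rw [mul_assoc]; exact mul_le_mul_of_nonneg_left h ht'
  have e2 : t' * (B * |orient v u y|) = (t * B) * |orient v u x| := by
    linear_combination B * habs
  rw [e2, hdot] at e1
  have := mul_pos (mul_pos (sub_pos.mpr hstrict) hU) hX
  nlinarith

namespace IsRadialOrder

variable {X : Finset (ℝ × ℝ)} {p : ℕ → ℝ × ℝ}

theorem ne (hp : IsRadialOrder X p) {a b : ℕ} (ha : a < X.card) (hb : b < X.card) (hab : a ≠ b) :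
    p a ≠ p b := fun h => hab (hp.injOn ha hb h)

theorem edge_eq_iff (hp : IsRadialOrder X p) {a b c d : ℕ} (ha : a < X.card) (hb : b < X.card)
    (hc : c < X.card) (hd : d < X.card) :
    s(p a, p b) = s(p c, p d) ↔ a = c ∧ b = d ∨ a = d ∧ b = c := by
  rw [Sym2.eq_iff, hp.injOn.eq_iff ha hc, hp.injOn.eq_iff hb hd, hp.injOn.eq_iff ha hd,
    hp.injOn.eq_iff hb hc]

theorem orient_ne_zero (hp : IsRadialOrder X p) (hX : GeneralPosition X) {a b c : ℕ}
    (ha : a < X.card) (hb : b < X.card) (hc : c < X.card) (hab : a ≠ b) (hac : a ≠ c)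
    (hbc : b ≠ c) : orient (p a) (p b) (p c) ≠ 0 :=
  hX.orient_ne_zero (hp.mem a ha) (hp.mem b hb) (hp.mem c hc) (hp.ne ha hb hab) (hp.ne ha hc hac)
    (hp.ne hb hc hbc)

theorem nonCrossing_common (hp : IsRadialOrder X p) (hX : GeneralPosition X) {a b c : ℕ}
    (ha : a < X.card) (hb : b < X.card) (hc : c < X.card) (hab : a ≠ b) (hac : a ≠ c)
    (hbc : b ≠ c) : NonCrossing s(p b, p a) s(p c, p a) := by
  rw [Sym2.eq_swap, Sym2.eq_swap (a := p c)]
  exact nonCrossing_of_common_endpoint (hp.orient_ne_zero hX ha hb hc hab hac hbc)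

theorem nonCrossing_separated (hp : IsRadialOrder X p) (hX : GeneralPosition X) {a b c d : ℕ}
    (hab : a < b) (hbc : b ≤ c) (hcd : c < d) (hd : d < X.card) :
    NonCrossing s(p b, p a) s(p d, p c) := by
  rcases hbc.eq_or_lt with rfl | hbc
  · rw [Sym2.eq_swap]
    exact hp.nonCrossing_common hX (by omega) (by omega) (by omega) (by omega) (by omega)
      (by omega)
  · rw [Sym2.eq_swap, Sym2.eq_swap (a := p d)]
    refine nonCrossing_of_orient_pos (o := p 0) ?_ (hp.orient_pos _ _ (by omega) hbc (by omega))
      (hp.orient_pos _ _ (by omega) (by omega) hd)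
    rcases Nat.eq_zero_or_pos a with rfl | ha
    · simp [orient]
    · exact (hp.orient_pos _ _ ha hab (by omega)).le

theorem nonCrossing_spoke (hp : IsRadialOrder X p) (hX : GeneralPosition X) {j k : ℕ}
    (hj : 1 ≤ j) (hjn : j + 1 < X.card) (hk : 1 ≤ k) (hkn : k < X.card) :
    NonCrossing s(p k, p 0) s(p j, p (j + 1)) := by
  rcases le_or_gt k j with h | h
  · rw [Sym2.eq_swap (a := p j)]
    exact hp.nonCrossing_separated hX (by omega) h (by omega) hjn
  rcases (show j + 1 ≤ k from h).eq_or_lt with rfl | h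
  · rw [Sym2.eq_swap]
    exact hp.nonCrossing_common hX (by omega) (by omega) (by omega) (by omega) (by omega)
      (by omega)
  · rw [Sym2.eq_swap]
    exact nonCrossing_of_orient_neg (hp.orient_pos _ _ hj (by omega) hkn)
      (hp.orient_pos _ _ (by omega) h hkn)

end IsRadialOrder

/-- The edges joining each of the points `p 1, …, p (n - 1)` to its parent, the parent of `p k`
being `p (g k)`. -/
noncomputable def parentTree (p : ℕ → ℝ × ℝ) (n : ℕ) (g : ℕ → ℕ) : Finset (Sym2 (ℝ × ℝ)) :=
  (Finset.Ico 1 n).image fun k => s(p k, p (g k))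

theorem parentTree_congr {p : ℕ → ℝ × ℝ} {n : ℕ} {g g' : ℕ → ℕ}
    (h : ∀ k, 1 ≤ k → k < n → g k = g' k) : parentTree p n g = parentTree p n g' :=
  Finset.image_congr fun k hk => by
    have := Finset.mem_Ico.mp hk
    simp only [h k this.1 this.2]

theorem mem_parentTree {p : ℕ → ℝ × ℝ} {n : ℕ} {g : ℕ → ℕ} {e : Sym2 (ℝ × ℝ)} :
    e ∈ parentTree p n g ↔ ∃ k, (1 ≤ k ∧ k < n) ∧ s(p k, p (g k)) = e := by
  simp [parentTree]

/-- The parent map `g` on `1, …, n - 1` is acyclic, and its edges do not cross. -/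
structure IsPlaneParentMap (p : ℕ → ℝ × ℝ) (n : ℕ) (g : ℕ → ℕ) : Prop where
  lt : ∀ k, 1 ≤ k → k < n → g k < n
  rank : ∃ r : ℕ → ℕ, ∀ k, 1 ≤ k → k < n → r (g k) < r k
  nonCrossing : ∀ j k, 1 ≤ j → j < k → k < n →
    NonCrossing s(p j, p (g j)) s(p k, p (g k))

namespace IsPlaneParentMap

variable {X : Finset (ℝ × ℝ)} {p : ℕ → ℝ × ℝ} {g : ℕ → ℕ}

theorem ne (hg : IsPlaneParentMap p X.card g) {k : ℕ} (hk : 1 ≤ k) (hkn : k < X.card) :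
    g k ≠ k := by
  obtain ⟨r, hr⟩ := hg.rank
  intro h
  have := hr k hk hkn
  rw [h] at this
  exact this.false

theorem eq_of_edge_eq (hp : IsRadialOrder X p) (hg : IsPlaneParentMap p X.card g) {j k : ℕ}
    (hj : 1 ≤ j) (hjn : j < X.card) (hk : 1 ≤ k) (hkn : k < X.card)
    (h : s(p j, p (g j)) = s(p k, p (g k))) : j = k := by
  obtain ⟨r, hr⟩ := hg.rank
  rcases (hp.edge_eq_iff hjn (hg.lt j hj hjn) hkn (hg.lt k hk hkn)).mp h with h | ⟨h1, h2⟩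
  · exact h.1
  · have h3 := hr j hj hjn
    have h4 := hr k hk hkn
    rw [h2] at h3
    rw [← h1] at h4
    omega

theorem isPlaneSpanningTree (hp : IsRadialOrder X p) (hg : IsPlaneParentMap p X.card g) :
    IsPlaneSpanningTree X (parentTree p X.card g) := by
  refine ⟨?_, ?_, ?_, ?_⟩
  · intro e he
    obtain ⟨k, ⟨hk, hkn⟩, rfl⟩ := mem_parentTree.mp he
    have hl := hg.lt k hk hkn
    exact ⟨p k, p (g k), rfl, hp.ne hkn hl (hg.ne hk hkn).symm, hp.mem _ hkn, hp.mem _ hl⟩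
  · rw [parentTree, Finset.card_image_of_injOn, Nat.card_Ico]
    intro j hj k hk h
    obtain ⟨hj, hjn⟩ := Finset.mem_Ico.mp hj
    obtain ⟨hk, hkn⟩ := Finset.mem_Ico.mp hk
    exact hg.eq_of_edge_eq hp hj hjn hk hkn h
  · obtain ⟨r, hr⟩ := hg.rank
    have hsymm : Std.Symm (Relation.ReflTransGen
        (fun a b => s(a, b) ∈ parentTree p X.card g)) := by
      have : Std.Symm (fun a b => s(a, b) ∈ parentTree p X.card g) :=
        ⟨fun a b h => by rwa [Sym2.eq_swap]⟩
      infer_instance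
    have hroot : ∀ m k, k < X.card → r k ≤ m → Relation.ReflTransGen
        (fun a b => s(a, b) ∈ parentTree p X.card g) (p k) (p 0) := by
      intro m
      induction m with
      | zero =>
        intro k hkn hk
        rcases Nat.eq_zero_or_pos k with rfl | hk0
        · exact .refl
        · have := hr k hk0 hkn
          omega
      | succ m ih =>
        intro k hkn hk
        rcases Nat.eq_zero_or_pos k with rfl | hk0
        · exact .refl
        · have := hr k hk0 hkn
          exact .head (mem_parentTree.mpr ⟨k, ⟨hk0, hkn⟩, rfl⟩)
            (ih (g k) (hg.lt k hk0 hkn) (by omega))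
    intro x hx y hy
    obtain ⟨i, hi, rfl⟩ := hp.surj x hx
    obtain ⟨j, hj, rfl⟩ := hp.surj y hy
    exact (hroot _ i hi le_rfl).trans (hsymm.symm _ _ (hroot _ j hj le_rfl))
  · intro e he f hf hef
    obtain ⟨j, ⟨hj, hjn⟩, rfl⟩ := mem_parentTree.mp he
    obtain ⟨k, ⟨hk, hkn⟩, rfl⟩ := mem_parentTree.mp hf
    rcases lt_trichotomy j k with h | rfl | h
    · exact hg.nonCrossing j k hj h hkn
    · exact absurd rfl hef
    · exact (hg.nonCrossing k j hk h hjn).symm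

end IsPlaneParentMap

/-- The position of the pair `s(a, b)` of natural numbers less than `n` in the order
`s(0, n - 1), …, s(n - 2, n - 1), s(0, n - 2), …, s(n - 3, n - 2), …, s(0, 1)`. -/
def pairRank (n : ℕ) (e : Sym2 ℕ) : ℕ :=
  e.inf + (n.choose 2 - (e.sup + 1).choose 2)

/-- The position of a pair of points of `X` when the points are indexed by `p`. -/
noncomputable def edgeRank (X : Finset (ℝ × ℝ)) (p : ℕ → ℝ × ℝ) (e : Sym2 (ℝ × ℝ)) : ℕ :=
  pairRank X.card (e.map (Function.invFunOn p (Set.Iio X.card)))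

/-- A flip to a plane spanning tree which raises the rank of the exchanged edge by one. -/
def RankStep (X : Finset (ℝ × ℝ)) (p : ℕ → ℝ × ℝ) (T T' : Finset (Sym2 (ℝ × ℝ))) : Prop :=
  IsPlaneSpanningTree X T' ∧
    ∃ e f, e ∈ T ∧ f ∉ T ∧ T' = insert f (T.erase e) ∧ edgeRank X p f = edgeRank X p e + 1

namespace IsRadialOrder

variable {X : Finset (ℝ × ℝ)} {p : ℕ → ℝ × ℝ}

theorem edgeRank_add (hp : IsRadialOrder X p) {a b : ℕ} (hab : a < b) (hb : b < X.card) :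
    edgeRank X p s(p b, p a) + (b + 1).choose 2 = a + X.card.choose 2 := by
  have hinv := hp.injOn.leftInvOn_invFunOn
  have hle : (b + 1).choose 2 ≤ X.card.choose 2 := Nat.choose_le_choose 2 hb
  simp only [edgeRank, pairRank, Sym2.map_mk, hinv (show b ∈ Set.Iio X.card from hb),
    hinv (show a ∈ Set.Iio X.card from hab.trans hb), Sym2.inf_mk, Sym2.sup_mk,
    inf_eq_right.mpr hab.le, sup_eq_left.mpr hab.le]
  omega

theorem rankStep_update (hp : IsRadialOrder X p) {g : ℕ → ℕ} {k v : ℕ}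
    (hg : IsPlaneParentMap p X.card g) (hg' : IsPlaneParentMap p X.card (Function.update g k v))
    (hk : 1 ≤ k) (hkn : k < X.card)
    (hrank : edgeRank X p s(p k, p v) = edgeRank X p s(p k, p (g k)) + 1) :
    RankStep X p (parentTree p X.card g) (parentTree p X.card (Function.update g k v)) := by
  refine ⟨hg'.isPlaneSpanningTree hp, s(p k, p (g k)), s(p k, p v),
    mem_parentTree.mpr ⟨k, ⟨hk, hkn⟩, rfl⟩, ?_, ?_, hrank⟩
  · intro h
    obtain ⟨j, ⟨hj, hjn⟩, he⟩ := mem_parentTree.mp h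
    rcases eq_or_ne j k with rfl | hjk
    · rw [he] at hrank
      omega
    · exact hjk (hg'.eq_of_edge_eq hp hj hjn hk hkn (by simpa [hjk] using he))
  · ext e
    simp only [Finset.mem_insert, Finset.mem_erase, mem_parentTree]
    constructor
    · rintro ⟨j, ⟨hj, hjn⟩, rfl⟩
      rcases eq_or_ne j k with rfl | hjk
      · simp
      · refine .inr ⟨fun h => hjk ?_, j, ⟨hj, hjn⟩, by simp [hjk]⟩
        exact hg.eq_of_edge_eq hp hj hjn hk hkn (by simpa [hjk] using h)
    · rintro (rfl | ⟨hne, j, ⟨hj, hjn⟩, rfl⟩)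
      · exact ⟨k, ⟨hk, hkn⟩, by simp⟩
      · have hjk : j ≠ k := by
          rintro rfl
          exact hne rfl
        exact ⟨j, ⟨hj, hjn⟩, by simp [hjk]⟩

end IsRadialOrder

/-- The parent map of the tree formed by the spokes from `p 0` to `p 1, …, p m` and `p (n - 1)`
and the path `p (m + 1), …, p (n - 1)`. -/
def fanMap (n m k : ℕ) : ℕ :=
  if k ≤ m ∨ k + 1 = n then 0 else k + 1

/-- The parent map of the tree formed by the path `p 0, …, p (i + 1)`, with the later points
attached to `p (i + 1)` if their index is in `S`, and to `p i` otherwise. -/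
def broomMap (i : ℕ) (S : Finset ℕ) (k : ℕ) : ℕ :=
  if k ≤ i + 1 then k - 1 else if k ∈ S then i + 1 else i

namespace IsRadialOrder

variable {X : Finset (ℝ × ℝ)} {p : ℕ → ℝ × ℝ}

theorem isPlaneParentMap_fanMap (hp : IsRadialOrder X p) (hX : GeneralPosition X) (m : ℕ) :
    IsPlaneParentMap p X.card (fanMap X.card m) := by
  refine ⟨fun k hk hkn => ?_, ⟨fun k => if k = 0 then 0 else X.card - k, fun k hk hkn => ?_⟩,
    fun j k hj hjk hkn => ?_⟩
  · unfold fanMap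
    split_ifs <;> omega
  · dsimp only [fanMap]
    split_ifs <;> omega
  · have h0 : fanMap X.card m j = 0 ∨ fanMap X.card m j = j + 1 := by
      unfold fanMap
      split_ifs <;> simp
    have h1 : fanMap X.card m k = 0 ∨ fanMap X.card m k = k + 1 ∧ k + 1 < X.card := by
      unfold fanMap
      split_ifs
      · simp
      · exact .inr ⟨rfl, by omega⟩
    rcases h0 with h0 | h0 <;> rcases h1 with h1 | ⟨h1, h1'⟩ <;> rw [h0, h1]
    · exact hp.nonCrossing_common hX (by omega) (by omega) hkn (by omega) (by omega) hjk.ne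
    · exact hp.nonCrossing_spoke hX (by omega) h1' hj (by omega)
    · exact (hp.nonCrossing_spoke hX hj (by omega) (by omega) hkn).symm
    · rw [Sym2.eq_swap, Sym2.eq_swap (a := p k)]
      exact hp.nonCrossing_separated hX (by omega) hjk (by omega) h1'

theorem isPlaneParentMap_broomMap (hp : IsRadialOrder X p) (hX : GeneralPosition X) {i : ℕ}
    (hi : i + 1 < X.card) {S : Finset ℕ}
    (hS : ∀ l ∈ S, ∀ k, i + 1 < k → k < X.card → k ∉ S →
      cotAngle (p i) (p (i + 1)) (p l) ≤ cotAngle (p i) (p (i + 1)) (p k)) :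
    IsPlaneParentMap p X.card (broomMap i S) := by
  have hdouble : ∀ l ∈ S, i + 1 < l → l < X.card → ∀ k, i + 1 < k → k < X.card → k ∉ S →
      NonCrossing s(p k, p i) s(p l, p (i + 1)) := by
    intro l hl hil hln k hik hkn hk
    rw [Sym2.eq_swap, Sym2.eq_swap (a := p l)]
    have hkl : k ≠ l := by
      rintro rfl
      exact hk hl
    exact nonCrossing_of_cotAngle_le (hp.ne (by omega) hi (by omega))
      (hp.orient_ne_zero hX hi (by omega) hkn (by omega) (by omega) (by omega))
      (hp.orient_ne_zero hX hi (by omega) hln (by omega) (by omega) (by omega))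
      (hp.orient_ne_zero hX hi hkn hln (by omega) (by omega) hkl) (hS l hl k hik hkn hk)
  have hlt : ∀ k, 1 ≤ k → broomMap i S k < k := by
    intro k hk
    unfold broomMap
    split_ifs <;> omega
  refine ⟨fun k hk hkn => (hlt k hk).trans hkn, ⟨id, fun k hk _ => hlt k hk⟩,
    fun j k hj hjk hkn => ?_⟩
  rcases le_or_gt k (i + 1) with hk | hk
  · simp only [broomMap, if_pos hk, if_pos (hjk.le.trans hk)]
    exact hp.nonCrossing_separated hX (by omega) (by omega) (by omega) hkn
  rcases le_or_gt j (i + 1) with hj' | hj'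
  · have h1 : broomMap i S j = j - 1 := if_pos hj'
    by_cases hjb : j ≤ broomMap i S k
    · rw [h1]
      exact hp.nonCrossing_separated hX (by omega) hjb (hlt k (by omega)) hkn
    · have h2 : broomMap i S k = i ∧ j = i + 1 := by
        unfold broomMap at hjb ⊢
        split_ifs at hjb ⊢ <;> omega
      rw [h1, h2.1, h2.2, Nat.add_sub_cancel]
      exact hp.nonCrossing_common hX (by omega) (by omega) hkn (by omega) (by omega) (by omega)
  · simp only [broomMap, if_neg hk.not_ge, if_neg hj'.not_ge]
    by_cases hjS : j ∈ S <;> by_cases hkS : k ∈ S <;> simp only [hjS, hkS, if_true, if_false]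
    · exact hp.nonCrossing_common hX hi (by omega) hkn (by omega) (by omega) hjk.ne
    · exact (hdouble j hjS hj' (by omega) k hk hkn hkS).symm
    · exact hdouble k hkS hk hkn j hj' (by omega) hjS
    · exact hp.nonCrossing_common hX (by omega) (by omega) hkn (by omega) (by omega) hjk.ne

theorem reflTransGen_fanMap (hp : IsRadialOrder X p) (hX : GeneralPosition X) (m : ℕ) :
    Relation.ReflTransGen (RankStep X p) (parentTree p X.card (fanMap X.card 0))
      (parentTree p X.card (fanMap X.card m)) := by
  induction m with
  | zero => exact .refl
  | succ m ih =>
    rcases lt_or_ge (m + 2) X.card with hm | hm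
    · have hupd : fanMap X.card (m + 1) = Function.update (fanMap X.card m) (m + 1) 0 := by
        ext k
        rcases eq_or_ne k (m + 1) with rfl | hk
        · simp [fanMap]
        · simp only [fanMap, Function.update_of_ne hk]
          congr 1
          simp only [eq_iff_iff]
          omega
      refine ih.tail ?_
      rw [hupd]
      refine hp.rankStep_update (hp.isPlaneParentMap_fanMap hX m)
        (hupd ▸ hp.isPlaneParentMap_fanMap hX (m + 1)) (by omega) (by omega) ?_
      have h : fanMap X.card m (m + 1) = m + 2 := if_neg (by omega)
      have h1 := hp.edgeRank_add (a := 0) (b := m + 1) (by omega) (by omega)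
      have h2 := hp.edgeRank_add (a := m + 1) (b := m + 2) (by omega) hm
      rw [h, Sym2.eq_swap (a := p (m + 1)) (b := p (m + 2))]
      have h3 : (m + 2 + 1).choose 2 = (m + 2) + (m + 1 + 1).choose 2 := by
        rw [Nat.choose_succ_succ' (m + 2) 1, Nat.choose_one_right]
      omega
    · rwa [parentTree_congr (g := fanMap X.card (m + 1)) (g' := fanMap X.card m)]
      intro k hk hkn
      unfold fanMap
      split_ifs <;> omega

theorem reflTransGen_broomMap (hp : IsRadialOrder X p) (hX : GeneralPosition X) {i : ℕ}
    (hi : i + 1 < X.card) :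
    Relation.ReflTransGen (RankStep X p) (parentTree p X.card (broomMap i ∅))
      (parentTree p X.card (broomMap i (Finset.Ioo (i + 1) X.card))) := by
  suffices h : ∀ m ≤ (Finset.Ioo (i + 1) X.card).card, ∃ S ⊆ Finset.Ioo (i + 1) X.card,
      S.card = m ∧
      (∀ l ∈ S, ∀ k, i + 1 < k → k < X.card → k ∉ S →
        cotAngle (p i) (p (i + 1)) (p l) ≤ cotAngle (p i) (p (i + 1)) (p k)) ∧
      Relation.ReflTransGen (RankStep X p) (parentTree p X.card (broomMap i ∅))
        (parentTree p X.card (broomMap i S)) by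
    obtain ⟨S, hS, hcard, -, h⟩ := h _ le_rfl
    rwa [Finset.eq_of_subset_of_card_le hS hcard.ge] at h
  intro m
  induction m with
  | zero => exact fun _ => ⟨∅, by simp, rfl, by simp, .refl⟩
  | succ m ih =>
    intro hm
    obtain ⟨S, hS, hcard, hlow, hreach⟩ := ih (by omega)
    obtain ⟨a, ha, hmin⟩ := (Finset.Ioo (i + 1) X.card \ S).exists_min_image
      (fun k => cotAngle (p i) (p (i + 1)) (p k)) (by
        rw [← Finset.card_pos, Finset.card_sdiff_of_subset hS]
        omega)
    simp only [Finset.mem_sdiff, Finset.mem_Ioo] at ha hmin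
    obtain ⟨⟨hia, han⟩, haS⟩ := ha
    have hlow' : ∀ l ∈ insert a S, ∀ k, i + 1 < k → k < X.card → k ∉ insert a S →
        cotAngle (p i) (p (i + 1)) (p l) ≤ cotAngle (p i) (p (i + 1)) (p k) := by
      intro l hl k hik hkn hk
      simp only [Finset.mem_insert, not_or] at hl hk
      rcases hl with rfl | hl
      · exact hmin k ⟨⟨hik, hkn⟩, hk.2⟩
      · exact hlow l hl k hik hkn hk.2
    have hupd : broomMap i (insert a S) = Function.update (broomMap i S) a (i + 1) := by
      ext k
      rcases eq_or_ne k a with rfl | hk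
      · simp [broomMap, hia.not_ge]
      · simp [broomMap, hk]
    refine ⟨insert a S, Finset.insert_subset (Finset.mem_Ioo.mpr ⟨hia, han⟩) hS,
      by rw [Finset.card_insert_of_notMem haS, hcard], hlow', hreach.tail ?_⟩
    rw [hupd]
    refine hp.rankStep_update (hp.isPlaneParentMap_broomMap hX hi hlow)
      (hupd ▸ hp.isPlaneParentMap_broomMap hX hi hlow') (by omega) han ?_
    have h : broomMap i S a = i := by simp [broomMap, hia.not_ge, haS]
    have h1 := hp.edgeRank_add (a := i) (b := a) (by omega) han
    have h2 := hp.edgeRank_add hia han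
    rw [h]
    omega

theorem reflTransGen_path (hp : IsRadialOrder X p) (hX : GeneralPosition X) (i : ℕ)
    (hi : i + 1 < X.card) :
    Relation.ReflTransGen (RankStep X p) (parentTree p X.card (broomMap 0 ∅))
      (parentTree p X.card (broomMap i ∅)) := by
  induction i with
  | zero => exact .refl
  | succ i ih =>
    refine (ih (by omega)).trans ?_
    rw [parentTree_congr (g := broomMap (i + 1) ∅)
      (g' := broomMap i (Finset.Ioo (i + 1) X.card))]
    · exact hp.reflTransGen_broomMap hX (by omega)
    · intro k hk hkn
      simp only [broomMap, Finset.mem_Ioo, Finset.notMem_empty, if_false]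
      split_ifs <;> omega

theorem exists_index (hp : IsRadialOrder X p) {e : Sym2 (ℝ × ℝ)}
    (he : e ∈ X.offDiag.image fun x => s(x.1, x.2)) :
    ∃ a b, a < b ∧ b < X.card ∧ e = s(p b, p a) := by
  obtain ⟨⟨x, y⟩, hxy, rfl⟩ := Finset.mem_image.mp he
  obtain ⟨hx, hy, hne⟩ := Finset.mem_offDiag.mp hxy
  obtain ⟨i, hi, rfl⟩ := hp.surj x hx
  obtain ⟨j, hj, rfl⟩ := hp.surj y hy
  rcases lt_trichotomy i j with h | rfl | h
  · exact ⟨i, j, h, hj, Sym2.eq_swap⟩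
  · exact absurd rfl hne
  · exact ⟨j, i, h, hi, rfl⟩

theorem edgeRank_lt (hp : IsRadialOrder X p) {a b : ℕ} (hab : a < b) (hb : b < X.card) :
    edgeRank X p s(p b, p a) < X.card.choose 2 := by
  have h := hp.edgeRank_add hab hb
  have : (b + 1).choose 2 = b + b.choose 2 := by
    rw [Nat.choose_succ_succ' b 1, Nat.choose_one_right]
  omega

theorem injOn_edgeRank (hp : IsRadialOrder X p) :
    Set.InjOn (edgeRank X p) (X.offDiag.image fun x => s(x.1, x.2) : Finset _) := by
  intro e he f hf hef
  obtain ⟨a, b, hab, hb, rfl⟩ := hp.exists_index he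
  obtain ⟨c, d, hcd, hd, rfl⟩ := hp.exists_index hf
  have h1 := hp.edgeRank_add hab hb
  have h2 := hp.edgeRank_add hcd hd
  have hs : ∀ n : ℕ, (n + 1).choose 2 = n + n.choose 2 := fun n => by
    rw [Nat.choose_succ_succ' n 1, Nat.choose_one_right]
  have hbd : b = d := by
    rcases lt_trichotomy b d with h | h | h
    · have := Nat.choose_le_choose 2 (show b + 1 ≤ d from h)
      have := hs d
      omega
    · exact h
    · have := Nat.choose_le_choose 2 (show d + 1 ≤ b from h)
      have := hs b
      omega
  subst hbd
  have : a = c := by omega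
  rw [this]

end IsRadialOrder

/-- For every finite set `X` of at least 3 points in general position, the
flip graph of plane spanning trees on `X` contains a 1-rainbow cycle; it has
length `C(|X|,2)`. -/
theorem plane_trees_one_rainbow_cycle (X : Finset (ℝ × ℝ)) (hX : 3 ≤ X.card)
    (hgen : GeneralPosition X) :
    ∃ V : ℕ → Finset (Sym2 (ℝ × ℝ)), IsRainbowCycleS X 1 (X.card.choose 2) V := by
  obtain ⟨p, hp⟩ := hgen.exists_isRadialOrder (Finset.card_pos.mp (by omega))
  set U : Finset (Sym2 (ℝ × ℝ)) := X.offDiag.image fun x => s(x.1, x.2)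
  have hUcard : U.card = X.card.choose 2 := Sym2.card_image_offDiag X
  obtain ⟨n, hn⟩ : ∃ n, X.card = n + 2 := ⟨X.card - 2, by omega⟩
  have hchain : Relation.ReflTransGen (RankStep X p) (parentTree p X.card (fanMap X.card 0))
      (parentTree p X.card (broomMap n ∅)) := by
    refine (hp.reflTransGen_fanMap hgen X.card).trans ?_
    rw [parentTree_congr (g := fanMap X.card X.card) (g' := broomMap 0 ∅)]
    · exact hp.reflTransGen_path hgen n (by omega)
    · intro k hk hkn
      simp only [fanMap, broomMap, Finset.notMem_empty]
      split_ifs <;> omega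
  have hpath : ∀ k < X.card, broomMap n ∅ k = k - 1 := fun k hk => if_pos (by omega)
  have hfirst : s(p 1, p 0) ∈ parentTree p X.card (broomMap n ∅) :=
    mem_parentTree.mpr ⟨1, by omega, by rw [hpath 1 (by omega)]⟩
  have hlast : s(p (n + 1), p 0) ∉ parentTree p X.card (broomMap n ∅) := by
    intro h
    obtain ⟨k, ⟨hk, hkn⟩, h⟩ := mem_parentTree.mp h
    rw [hpath k hkn, hp.edge_eq_iff hkn (by omega) (by omega) (by omega)] at h
    omega
  have hclose : parentTree p X.card (fanMap X.card 0) =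
      insert s(p (n + 1), p 0) ((parentTree p X.card (broomMap n ∅)).erase s(p 1, p 0)) := by
    ext e
    simp only [Finset.mem_insert, Finset.mem_erase, mem_parentTree]
    constructor
    · rintro ⟨k, ⟨hk, hkn⟩, rfl⟩
      rcases eq_or_ne k (n + 1) with rfl | hkl
      · left
        rw [fanMap, if_pos (by omega)]
      · right
        rw [fanMap, if_neg (by omega)]
        refine ⟨?_, k + 1, by omega, ?_⟩
        · rw [Ne, hp.edge_eq_iff hkn (by omega) (by omega) (by omega)]
          omega
        · rw [hpath (k + 1) (by omega), Sym2.eq_swap, Nat.add_sub_cancel]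
    · rintro (rfl | ⟨hne, k, ⟨hk, hkn⟩, rfl⟩)
      · exact ⟨n + 1, by omega, by rw [fanMap, if_pos (by omega)]⟩
      · rw [hpath k hkn] at hne ⊢
        have hk1 : k ≠ 1 := by
          rintro rfl
          exact hne rfl
        refine ⟨k - 1, by omega, ?_⟩
        rw [fanMap, if_neg (by omega), Nat.sub_add_cancel hk, Sym2.eq_swap]
  have hsub : ∀ T, IsPlaneSpanningTree X T → T ⊆ U := by
    intro T hT e he
    obtain ⟨x, y, rfl, hxy, hx, hy⟩ := hT.1 e he
    exact Finset.mem_image.mpr ⟨(x, y), Finset.mem_offDiag.mpr ⟨hx, hy, hxy⟩, rfl⟩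
  have hchoose : 0 < X.card.choose 2 := Nat.choose_pos (by omega)
  obtain ⟨V, hper, hinj, htree, hflip, hcount⟩ :=
    exists_cycle_of_weight_chain (IsPlaneSpanningTree X) U hsub (edgeRank X p) hp.injOn_edgeRank
      (fun e he => by
        obtain ⟨a, b, hab, hb, rfl⟩ := hp.exists_index he
        rw [hUcard]
        exact hp.edgeRank_lt hab hb)
      ((hp.isPlaneParentMap_fanMap hgen 0).isPlaneSpanningTree hp) hchain hfirst hlast hclose
      (by
        have := hp.edgeRank_add (a := 0) (b := 1) (by omega) (by omega)
        simp only [Nat.reduceAdd, Nat.choose_self] at this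
        omega)
      (by
        have := hp.edgeRank_add (a := 0) (b := n + 1) (by omega) (by omega)
        rw [← show X.card = n + 1 + 1 from hn] at this
        omega)
  rw [hUcard] at hper hinj hcount
  exact ⟨V, hchoose, hper, hinj, htree, hflip, fun x hx y hy hxy => hcount _
    (Finset.mem_image.mpr ⟨(x, y), Finset.mem_offDiag.mpr ⟨hx, hy, hxy⟩, rfl⟩)⟩
end
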